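/- (Proposition 3.1) Let ν = η = ε = 1 and let (u, b, π) be a smooth solution of the 2½-dimensional Hall-MHD system on [0,T] × ℝ², Schwartz-class in the space variable for each t. Assume the energy-class bounds sup_{0≤t≤T} ∫_{ℝ²} (|u(t,x)|² + |b(t,x)|²) dx < ∞ and ∫₀ᵀ ∫_{ℝ²} (|∇u|² + |∇b|²) dx dt < ∞, and that ∫_{ℝ²} |ω(0,x)|² dx < ∞ where ω = ∇×u. Then ω ∈ L^∞_T L²_x ∩ L²_T Ḣ¹_x, i.e., sup_{0≤t≤T} ∫_{ℝ²} |ω(t,x)|² dx < ∞ and ∫₀ᵀ ∫_{ℝ²} |∇ω(t,x)|² dx dt < ∞. -/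

import Mathlib

open MeasureTheory
open scoped ENNReal

noncomputable section

/-- Partial derivative in the `i`-th coordinate direction of `ℝ²`. -/
def pd (i : Fin 2) (f : (Fin 2 → ℝ) → ℝ) (x : Fin 2 → ℝ) : ℝ :=
  fderiv ℝ f x (Pi.single i 1)

/-- The Laplacian `Δ = ∂₁² + ∂₂²` of a scalar function on `ℝ²`. -/
def lap (f : (Fin 2 → ℝ) → ℝ) (x : Fin 2 → ℝ) : ℝ :=
  pd 0 (pd 0 f) x + pd 1 (pd 1 f) x

/-- The 2½-dimensional curl `∇×F = (∂₂F₃, −∂₁F₃, ∂₁F₂ − ∂₂F₁)` of `F : ℝ² → ℝ³`. -/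
def curl (F : (Fin 2 → ℝ) → (Fin 3 → ℝ)) (x : Fin 2 → ℝ) : Fin 3 → ℝ :=
  ![pd 1 (fun y => F y 2) x, -(pd 0 (fun y => F y 2) x),
    pd 0 (fun y => F y 1) x - pd 1 (fun y => F y 0) x]

/-- The advection term `(f·∇)g = f₁∂₁g + f₂∂₂g` for `f, g : ℝ² → ℝ³`. -/
def advect (f g : (Fin 2 → ℝ) → (Fin 3 → ℝ)) (x : Fin 2 → ℝ) (i : Fin 3) : ℝ :=
  f x 0 * pd 0 (fun y => g y i) x + f x 1 * pd 1 (fun y => g y i) x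

/-- A function is Schwartz-class: it is smooth and all its iterated derivatives decay
faster than any polynomial. -/
def IsSchwartz {F : Type*} [NormedAddCommGroup F] [NormedSpace ℝ F]
    (f : (Fin 2 → ℝ) → F) : Prop :=
  ContDiff ℝ (⊤ : ℕ∞) f ∧
    ∀ k n : ℕ, ∃ C : ℝ, ∀ x, ‖x‖ ^ k * ‖iteratedFDeriv ℝ n f x‖ ≤ C

/-- A smooth solution of the 2½-dimensional Hall-MHD system on `S × ℝ²`, Schwartz-class in
the space variable for each time `t ∈ S`:
`∂ₜu + (u·∇)u + ∇π = νΔu + (b·∇)b`, `∂ₜb + (u·∇)b = ηΔb + (b·∇)u − ε∇×(j×b)`,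
`∂₁u₁ + ∂₂u₂ = 0`, `∂₁b₁ + ∂₂b₂ = 0`, where `j = ∇×b`. -/
structure IsHallMHDSolution (ν η ε : ℝ) (S : Set ℝ)
    (u b : ℝ → (Fin 2 → ℝ) → (Fin 3 → ℝ)) (π : ℝ → (Fin 2 → ℝ) → ℝ) : Prop where
  smooth_u : ContDiffOn ℝ (⊤ : ℕ∞) (fun p : ℝ × (Fin 2 → ℝ) => u p.1 p.2) (S ×ˢ Set.univ)
  smooth_b : ContDiffOn ℝ (⊤ : ℕ∞) (fun p : ℝ × (Fin 2 → ℝ) => b p.1 p.2) (S ×ˢ Set.univ)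
  smooth_pi : ContDiffOn ℝ (⊤ : ℕ∞) (fun p : ℝ × (Fin 2 → ℝ) => π p.1 p.2) (S ×ˢ Set.univ)
  schwartz_u : ∀ t ∈ S, IsSchwartz (u t)
  schwartz_b : ∀ t ∈ S, IsSchwartz (b t)
  schwartz_pi : ∀ t ∈ S, IsSchwartz (π t)
  div_u : ∀ t ∈ S, ∀ x, pd 0 (fun y => u t y 0) x + pd 1 (fun y => u t y 1) x = 0
  div_b : ∀ t ∈ S, ∀ x, pd 0 (fun y => b t y 0) x + pd 1 (fun y => b t y 1) x = 0
  momentum : ∀ t ∈ S, ∀ x, ∀ i : Fin 3,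
    deriv (fun s => u s x i) t + advect (u t) (u t) x i
        + ![pd 0 (π t) x, pd 1 (π t) x, 0] i
      = ν * lap (fun y => u t y i) x + advect (b t) (b t) x i
  induction : ∀ t ∈ S, ∀ x, ∀ i : Fin 3,
    deriv (fun s => b s x i) t + advect (u t) (b t) x i
      = η * lap (fun y => b t y i) x + advect (b t) (u t) x i
        - ε * curl (fun y => crossProduct (curl (b t) y) (b t y)) x i

/-- The `Hᵐ(ℝ²)` norm: `‖f‖_{Hᵐ} = (∑_{k=0}^{m} ∫ ‖Dᵏf(x)‖² dx)^{1/2}`. -/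
def hSobNorm (m : ℕ) (f : (Fin 2 → ℝ) → (Fin 3 → ℝ)) : ℝ :=
  Real.sqrt (∑ k ∈ Finset.range (m + 1), ∫ x, ‖iteratedFDeriv ℝ k f x‖ ^ 2)

end

set_option linter.unusedSimpArgs false
set_option linter.unusedVariables false

section
open MeasureTheory
open scoped ENNReal

/-- The plane. -/
abbrev R2 := Fin 2 → ℝ

/-- Smooth scalar functions on the plane. -/
abbrev Sm (f : R2 → ℝ) : Prop := ContDiff ℝ (⊤ : ℕ∞) f

lemma Sm.diff {f : R2 → ℝ} (hf : Sm f) : Differentiable ℝ f := hf.differentiable (by simp)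

lemma Sm.pd {f : R2 → ℝ} (hf : Sm f) (k : Fin 2) : Sm (pd k f) := by
  have h : ContDiff ℝ (⊤ : ℕ∞) (fderiv ℝ f) := hf.fderiv_right (by exact_mod_cast le_top)
  exact h.clm_apply contDiff_const

lemma pd_add {f g : R2 → ℝ} (hf : Sm f) (hg : Sm g) (k : Fin 2) (x : R2) :
    pd k (fun y => f y + g y) x = pd k f x + pd k g x := by
  unfold pd
  rw [fderiv_fun_add (hf.diff x) (hg.diff x)]; simp

lemma pd_sub {f g : R2 → ℝ} (hf : Sm f) (hg : Sm g) (k : Fin 2) (x : R2) :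
    pd k (fun y => f y - g y) x = pd k f x - pd k g x := by
  unfold pd
  rw [fderiv_fun_sub (hf.diff x) (hg.diff x)]; simp

lemma pd_neg {f : R2 → ℝ} (k : Fin 2) (x : R2) :
    pd k (fun y => - f y) x = - pd k f x := by
  unfold pd
  rw [fderiv_fun_neg]; simp

lemma pd_mul {f g : R2 → ℝ} (hf : Sm f) (hg : Sm g) (k : Fin 2) (x : R2) :
    pd k (fun y => f y * g y) x = pd k f x * g x + f x * pd k g x := by
  unfold pd
  rw [fderiv_fun_mul (hf.diff x) (hg.diff x)]; simp; ring

lemma pd_comm {f : R2 → ℝ} (hf : Sm f) (k l : Fin 2) (x : R2) :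
    pd k (pd l f) x = pd l (pd k f) x := by
  have hd : Differentiable ℝ (fderiv ℝ f) :=
    (hf.fderiv_right (m := (⊤ : ℕ∞)) (by exact_mod_cast le_top)).differentiable (by simp)
  have key : ∀ i j : Fin 2, pd i (pd j f) x
      = fderiv ℝ (fderiv ℝ f) x (Pi.single i 1) (Pi.single j 1) := by
    intro i j
    have : HasFDerivAt (pd j f)
        ((ContinuousLinearMap.apply ℝ ℝ (Pi.single j (1 : ℝ) : R2)).comp
          (fderiv ℝ (fderiv ℝ f) x)) x :=
      (ContinuousLinearMap.apply ℝ ℝ (Pi.single j (1 : ℝ) : R2)).hasFDerivAt.comp x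
        (hd x).hasFDerivAt
    change fderiv ℝ (pd j f) x _ = _
    rw [this.fderiv]; simp
  rw [key, key]
  have hs : IsSymmSndFDerivAt ℝ f x :=
    hf.contDiffAt.isSymmSndFDerivAt (by
      rw [minSmoothness_of_isRCLikeNormedField]
      exact WithTop.coe_le_coe.2 (le_top : (2 : ℕ∞) ≤ ⊤))
  exact hs _ _

lemma pd_hasCompactSupport {f : R2 → ℝ} (h : HasCompactSupport f) (k : Fin 2) :
    HasCompactSupport (pd k f) := by
  have := h.fderiv_apply (𝕜 := ℝ) (Pi.single k (1 : ℝ) : R2)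
  exact this

lemma integral_pd_zero {f : R2 → ℝ} (hf : Sm f) (h : HasCompactSupport f) (k : Fin 2) :
    ∫ x, pd k f x = 0 := by
  have h1 : Integrable (fun x => fderiv ℝ f x (Pi.single k 1)) :=
    (hf.pd k).continuous.integrable_of_hasCompactSupport (pd_hasCompactSupport h k)
  have := integral_mul_fderiv_eq_neg_fderiv_mul_of_integrable (𝕜 := ℝ) (μ := volume)
    (f := fun _ : R2 => (1 : ℝ)) (g := f) (v := Pi.single k 1) (by simp)
    (by simpa using h1)
    (by simpa using hf.continuous.integrable_of_hasCompactSupport h)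
    (fun x _ => by fun_prop) (fun x _ => hf.diff x)
  simp at this
  exact this

/-- Cauchy-Schwarz for integrals. -/
lemma cs_integral {α : Type*} [MeasurableSpace α] {μ : Measure α} {f g : α → ℝ}
    (hf : Integrable (fun x => f x ^ 2) μ)
    (hg : Integrable (fun x => g x ^ 2) μ) (hfg : Integrable (fun x => f x * g x) μ) :
    (∫ x, f x * g x ∂μ) ^ 2 ≤ (∫ x, f x ^ 2 ∂μ) * ∫ x, g x ^ 2 ∂μ := by
  have key : ∀ s : ℝ, 0 ≤ (∫ x, g x ^ 2 ∂μ) * (s * s) + (2 * ∫ x, f x * g x ∂μ) * s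
      + ∫ x, f x ^ 2 ∂μ := by
    intro s
    have h0 : 0 ≤ ∫ x, (f x + s * g x) ^ 2 ∂μ := integral_nonneg fun x => sq_nonneg _
    have : ∫ x, (f x + s * g x) ^ 2 ∂μ
        = ∫ x, ((s * s) * g x ^ 2 + ((2 * s) * (f x * g x) + f x ^ 2)) ∂μ := by
      congr 1; ext x; ring
    have ia : Integrable (fun x => (2 * s) * (f x * g x) + f x ^ 2) μ := (hfg.const_mul _).add hf
    rw [this, integral_add (hg.const_mul _) ia,
      integral_add (hfg.const_mul _) hf, integral_const_mul, integral_const_mul] at h0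
    linarith
  have := discrim_le_zero key
  unfold discrim at this
  nlinarith

lemma fderiv_norm_le (f : R2 → ℝ) (x : R2) :
    ‖fderiv ℝ f x‖ ≤ |pd 0 f x| + |pd 1 f x| := by
  refine ContinuousLinearMap.opNorm_le_bound _ (by positivity) fun v => ?_
  have hv : v = v 0 • (Pi.single 0 1 : R2) + v 1 • (Pi.single 1 1 : R2) := by
    ext i; fin_cases i <;> simp
  have : fderiv ℝ f x v = v 0 * pd 0 f x + v 1 * pd 1 f x := by
    conv_lhs => rw [hv]
    rw [map_add, map_smul, map_smul]; rfl
  rw [this]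
  have h0 := norm_le_pi_norm v 0
  have h1 := norm_le_pi_norm v 1
  rw [Real.norm_eq_abs] at *
  calc |v 0 * pd 0 f x + v 1 * pd 1 f x| ≤ |v 0| * |pd 0 f x| + |v 1| * |pd 1 f x| := by
        rw [← abs_mul, ← abs_mul]; exact abs_add_le _ _
    _ ≤ ‖v‖ * |pd 0 f x| + ‖v‖ * |pd 1 f x| := by gcongr
    _ = _ := by ring

/-- The Ladyzhenskaya inequality. -/
lemma ladyzhenskaya {f : R2 → ℝ} (hf : Sm f) (h : HasCompactSupport f) :
    ∫ x, f x ^ 4 ≤ 8 * ((∫ x, f x ^ 2) * ∫ x, (pd 0 f x ^ 2 + pd 1 f x ^ 2)) := by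
  have hc := hf.continuous
  have hp0 := (hf.pd 0).continuous
  have hp1 := (hf.pd 1).continuous
  have s0 := pd_hasCompactSupport h 0
  have s1 := pd_hasCompactSupport h 1
  have hsm : ContDiff ℝ 1 (fun x => f x ^ 2) := (hf.pow 2).of_le (by exact_mod_cast le_top)
  have hcs : HasCompactSupport (fun x => f x ^ 2) := h.comp_left (g := fun y : ℝ => y ^ 2) (by simp)
  have conj : Real.HolderConjugate (Fintype.card (Fin 2)) 2 := by
    rw [Real.holderConjugate_iff]; norm_num
  have G := lintegral_pow_le_pow_lintegral_fderiv_aux conj hsm hcs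
  obtain ⟨D, hD⟩ : ∃ D : R2 → ℝ, ∀ x, D x = |pd 0 f x| + |pd 1 f x| := ⟨_, fun x => rfl⟩
  have hD' : D = fun x => |pd 0 f x| + |pd 1 f x| := funext hD
  have D0 : ∀ x, 0 ≤ D x := fun x => by rw [hD]; positivity
  have hDc : Continuous D := by rw [hD']; fun_prop
  have Dle : ∀ x, ‖fderiv ℝ (fun x => f x ^ 2) x‖ₑ ≤ ENNReal.ofReal (2 * (|f x| * D x)) := by
    intro x
    rw [← ofReal_norm]
    apply ENNReal.ofReal_le_ofReal
    have : fderiv ℝ (fun x => f x ^ 2) x = (2 * f x) • fderiv ℝ f x := by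
      rw [((hf.diff x).hasFDerivAt.pow 2).fderiv]; simp
    rw [this, norm_smul, Real.norm_eq_abs, abs_mul, abs_two, mul_assoc]
    rw [hD]
    gcongr
    exact fderiv_norm_le f x
  have i2 : Integrable (fun x => f x ^ 2) := by
    apply Continuous.integrable_of_hasCompactSupport (by fun_prop) hcs
  have iabs2 : Integrable (fun x => |f x| ^ 2) := by simpa using i2
  have i4 : Integrable (fun x => f x ^ 4) := by
    apply Continuous.integrable_of_hasCompactSupport (by fun_prop)
    exact h.comp_left (g := fun y : ℝ => y ^ 4) (by simp)
  have iD : Integrable (fun x => D x ^ 2) := by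
    apply Continuous.integrable_of_hasCompactSupport (by fun_prop)
    have : HasCompactSupport D := by
      rw [hD']
      exact (s0.comp_left (g := fun y : ℝ => |y|) (by simp)).add
        (s1.comp_left (g := fun y : ℝ => |y|) (by simp))
    exact this.comp_left (g := fun y : ℝ => y ^ 2) (by simp)
  have ifD : Integrable (fun x => |f x| * D x) := by
    apply Continuous.integrable_of_hasCompactSupport (by fun_prop)
    exact (h.comp_left (g := fun y : ℝ => |y|) (by simp)).mul_right
  have iG : Integrable (fun x => pd 0 f x ^ 2 + pd 1 f x ^ 2) := by
    apply Continuous.integrable_of_hasCompactSupport (by fun_prop)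
    exact (s0.comp_left (g := fun y : ℝ => y ^ 2) (by simp)).add
      (s1.comp_left (g := fun y : ℝ => y ^ 2) (by simp))
  have R : ENNReal.ofReal (∫ x, f x ^ 4) ≤ ENNReal.ofReal ((∫ x, 2 * (|f x| * D x)) ^ 2) := by
    rw [ofReal_integral_eq_lintegral_ofReal i4 (ae_of_all _ fun x => by positivity),
      ENNReal.ofReal_pow (integral_nonneg fun x => mul_nonneg zero_le_two (mul_nonneg (abs_nonneg _) (D0 x))),
      ofReal_integral_eq_lintegral_ofReal (ifD.const_mul 2)
        (ae_of_all _ fun x => mul_nonneg zero_le_two (mul_nonneg (abs_nonneg _) (D0 x)))]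
    calc ∫⁻ x, ENNReal.ofReal (f x ^ 4) = ∫⁻ x, ‖f x ^ 2‖ₑ ^ (2 : ℝ) := by
          congr 1; ext x
          rw [← ofReal_norm, ENNReal.ofReal_rpow_of_nonneg (by positivity) (by norm_num)]
          congr 1
          simp; ring
      _ ≤ _ := G
      _ = (∫⁻ x, ‖fderiv ℝ (fun x => f x ^ 2) x‖ₑ) ^ 2 := by
          rw [← ENNReal.rpow_natCast]; norm_num
      _ ≤ _ := by gcongr with x; exact Dle x
  rw [ENNReal.ofReal_le_ofReal_iff (by positivity), integral_const_mul] at R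
  have C := cs_integral iabs2 iD ifD
  simp only [sq_abs] at C
  have L : ∫ x, D x ^ 2 ≤ 2 * ∫ x, (pd 0 f x ^ 2 + pd 1 f x ^ 2) := by
    rw [← integral_const_mul]
    refine integral_mono iD (iG.const_mul 2) fun x => ?_
    rw [hD, ← sq_abs (pd 0 f x), ← sq_abs (pd 1 f x)]
    nlinarith [sq_nonneg (|pd 0 f x| - |pd 1 f x|)]
  have : (∫ x, f x ^ 2) * (∫ x, D x ^ 2)
      ≤ (∫ x, f x ^ 2) * (2 * ∫ x, (pd 0 f x ^ 2 + pd 1 f x ^ 2)) := by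
    apply mul_le_mul_of_nonneg_left L; exact integral_nonneg fun x => sq_nonneg _
  nlinarith

lemma int_off {f : R2 → ℝ} (hc : Continuous f) {K : Set R2} (hK : IsCompact K)
    (h : ∀ x, x ∉ K → f x = 0) : Integrable f :=
  hc.integrable_of_hasCompactSupport (HasCompactSupport.intro hK h)

lemma int_eq_on {f : R2 → ℝ} {K : Set R2} (h : ∀ x, x ∉ K → f x = 0) :
    ∫ x, f x = ∫ x in K, f x :=
  (setIntegral_eq_integral_of_forall_compl_eq_zero h).symm

lemma int_on {f : R2 → ℝ} (hc : Continuous f) {K : Set R2} (hK : IsCompact K) :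
    IntegrableOn f K := hc.continuousOn.integrableOn_compact hK

lemma int_on_mono {f g : R2 → ℝ} (hf : Continuous f) (hg : Continuous g) {K : Set R2}
    (hK : IsCompact K) (h : ∀ x, f x ≤ g x) : ∫ x in K, f x ≤ ∫ x in K, g x :=
  integral_mono (int_on hf hK) (int_on hg hK) h

lemma cs_on {f g : R2 → ℝ} (hf : Continuous f) (hg : Continuous g) {K : Set R2}
    (hK : IsCompact K) :
    (∫ x in K, f x * g x) ^ 2 ≤ (∫ x in K, f x ^ 2) * ∫ x in K, g x ^ 2 :=
  cs_integral (int_on (by fun_prop) hK) (int_on (by fun_prop) hK) (int_on (by fun_prop) hK)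
end

section
open MeasureTheory
open scoped ENNReal

lemma pd_off {f : R2 → ℝ} {K : Set R2} (h : tsupport f ⊆ K) (k : Fin 2) {x : R2} (hx : x ∉ K) :
    pd k f x = 0 := by
  unfold pd
  have : x ∉ tsupport (fderiv ℝ f) := fun h' => hx (h (tsupport_fderiv_subset ℝ h'))
  rw [image_eq_zero_of_notMem_tsupport this]; simp

lemma val_off {f : R2 → ℝ} {K : Set R2} (h : tsupport f ⊆ K) {x : R2} (hx : x ∉ K) :
    f x = 0 := image_eq_zero_of_notMem_tsupport fun h' => hx (h h')

lemma vec_ladyzhenskaya {w : Fin 3 → R2 → ℝ} (hw : ∀ i, Sm (w i)) {K : Set R2} (hK : IsCompact K)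
    (h : ∀ i, tsupport (w i) ⊆ K) :
    ∫ x in K, (∑ i, w i x ^ 2) ^ 2 ≤ 24 * ((∫ x in K, ∑ i, w i x ^ 2) *
      ∫ x in K, ∑ i, ∑ k, (pd k (w i) x) ^ 2) := by
  have hc := fun i => (hw i).continuous
  have hp := fun i k => ((hw i).pd k).continuous
  have L : ∀ i, ∫ x in K, w i x ^ 4 ≤ 8 * ((∫ x in K, w i x ^ 2) *
      ∫ x in K, ∑ k, (pd k (w i) x) ^ 2) := by
    intro i
    have := ladyzhenskaya (hw i) (hK.of_isClosed_subset (isClosed_tsupport _) (h i))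
    rw [int_eq_on (K := K), int_eq_on (K := K), int_eq_on (K := K)] at this
    · simpa only [Fin.sum_univ_two] using this
    · intro x hx; simp [pd_off (h i) _ hx]
    · intro x hx; simp [val_off (h i) hx]
    · intro x hx; simp [val_off (h i) hx]
  have A : ∫ x in K, (∑ i, w i x ^ 2) ^ 2 ≤ ∫ x in K, 3 * ∑ i, w i x ^ 4 := by
    refine int_on_mono (by fun_prop) (by fun_prop) hK fun x => ?_
    simp only [Fin.sum_univ_three]
    nlinarith [sq_nonneg (w 0 x ^ 2 - w 1 x ^ 2), sq_nonneg (w 0 x ^ 2 - w 2 x ^ 2),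
      sq_nonneg (w 1 x ^ 2 - w 2 x ^ 2)]
  have e1 : ∫ x in K, 3 * ∑ i, w i x ^ 4 = 3 * ∑ i, ∫ x in K, w i x ^ 4 := by
    rw [integral_const_mul, integral_finsetSum _ (fun i _ => int_on (by fun_prop) hK)]
  have e2 : ∫ x in K, ∑ i, w i x ^ 2 = ∑ i, ∫ x in K, w i x ^ 2 := by
    rw [integral_finsetSum _ (fun i _ => int_on (by fun_prop) hK)]
  have e3 : ∫ x in K, ∑ i, ∑ k, (pd k (w i) x) ^ 2 = ∑ i, ∫ x in K, ∑ k, (pd k (w i) x) ^ 2 := by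
    rw [integral_finsetSum _ (fun i _ => int_on (by fun_prop) hK)]
  rw [e1] at A
  rw [e2, e3]
  refine A.trans ?_
  obtain ⟨P, hP⟩ : ∃ P : Fin 3 → ℝ, ∀ i, P i = ∫ x in K, w i x ^ 2 := ⟨_, fun _ => rfl⟩
  obtain ⟨Q, hQ⟩ : ∃ Q : Fin 3 → ℝ, ∀ i, Q i = ∫ x in K, ∑ k, (pd k (w i) x) ^ 2 :=
    ⟨_, fun _ => rfl⟩
  have P0 : ∀ i, 0 ≤ P i := fun i => by rw [hP]; exact integral_nonneg fun x => sq_nonneg _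
  have Q0 : ∀ i, 0 ≤ Q i := fun i => by
    rw [hQ]; exact integral_nonneg fun x => Finset.sum_nonneg fun _ _ => sq_nonneg _
  simp only [← hP, ← hQ, Fin.sum_univ_three] at L ⊢
  have m := fun i j => mul_nonneg (P0 i) (Q0 j)
  nlinarith [L 0, L 1, L 2, m 0 1, m 0 2, m 1 0, m 1 2, m 2 0, m 2 1]

lemma Sm.mul {f g : R2 → ℝ} (hf : Sm f) (hg : Sm g) : Sm (fun x => f x * g x) :=
  ContDiff.mul hf hg
lemma Sm.add {f g : R2 → ℝ} (hf : Sm f) (hg : Sm g) : Sm (fun x => f x + g x) :=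
  ContDiff.add hf hg
lemma Sm.sub {f g : R2 → ℝ} (hf : Sm f) (hg : Sm g) : Sm (fun x => f x - g x) :=
  ContDiff.sub hf hg
lemma Sm.neg {f : R2 → ℝ} (hf : Sm f) : Sm (fun x => - f x) :=
  ContDiff.neg hf
lemma Sm.lap {f : R2 → ℝ} (hf : Sm f) : Sm (lap f) :=
  ((hf.pd 0).pd 0).add ((hf.pd 1).pd 1)

/-- Localized energy identity for the advection-diffusion operator. -/
lemma scalar_ibp {ζ β v0 v1 : R2 → ℝ} (hζ : Sm ζ) (hβ : Sm β) (h0 : Sm v0) (h1 : Sm v1)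
    {K : Set R2} (hK : IsCompact K) (hs : tsupport ζ ⊆ K)
    (hdiv : ∀ x, pd 0 v0 x + pd 1 v1 x = 0) :
    ∫ x in K, ζ x * (2 * β x * (lap β x - (v0 x * pd 0 β x + v1 x * pd 1 β x)))
      = ∫ x in K, (-2 * ζ x * (pd 0 β x ^ 2 + pd 1 β x ^ 2)
        - 2 * β x * (pd 0 ζ x * pd 0 β x + pd 1 ζ x * pd 1 β x)
        + β x ^ 2 * (v0 x * pd 0 ζ x + v1 x * pd 1 ζ x)) := by
  have hV : ∀ (k : Fin 2) (v : R2 → ℝ), Sm v →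
      Sm (fun x => ζ x * (β x * (pd k β x + pd k β x - v x * β x))) := fun k v hv =>
    hζ.mul (hβ.mul (((hβ.pd k).add (hβ.pd k)).sub (hv.mul hβ)))
  have hz : ∀ (k : Fin 2) (v : R2 → ℝ), Sm v →
      ∫ x in K, pd k (fun x => ζ x * (β x * (pd k β x + pd k β x - v x * β x))) x = 0 := by
    intro k v hv
    have ht : tsupport (fun x => ζ x * (β x * (pd k β x + pd k β x - v x * β x))) ⊆ K :=
      (tsupport_mul_subset_left).trans hs
    rw [← int_eq_on (fun x hx => pd_off ht k hx)]
    exact integral_pd_zero (hV k v hv) (hK.of_isClosed_subset (isClosed_tsupport _) ht) k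
  have hcomp : ∀ (k : Fin 2) (v : R2 → ℝ), Sm v → ∀ x,
      pd k (fun x => ζ x * (β x * (pd k β x + pd k β x - v x * β x))) x
      = pd k ζ x * (β x * (2 * pd k β x - v x * β x)) + ζ x * (pd k β x *
        (2 * pd k β x - v x * β x) + β x * (2 * pd k (pd k β) x - pd k v x * β x
          - v x * pd k β x)) := by
    intro k v hv x
    rw [pd_mul hζ (hβ.mul (((hβ.pd k).add (hβ.pd k)).sub (hv.mul hβ))),
      pd_mul hβ (((hβ.pd k).add (hβ.pd k)).sub (hv.mul hβ)),
      pd_sub ((hβ.pd k).add (hβ.pd k)) (hv.mul hβ), pd_add (hβ.pd k) (hβ.pd k), pd_mul hv hβ]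
    ring
  have hcV : ∀ (k : Fin 2) (v : R2 → ℝ), Sm v → IntegrableOn
      (pd k (fun x => ζ x * (β x * (pd k β x + pd k β x - v x * β x)))) K := fun k v hv =>
    int_on ((hV k v hv).pd k).continuous hK
  have cζ := hζ.continuous
  have cβ := hβ.continuous
  have c0 := h0.continuous
  have c1 := h1.continuous
  have cp := fun k => (hβ.pd k).continuous
  have cz := fun k => (hζ.pd k).continuous
  rw [← sub_eq_zero, ← integral_sub]
  · rw [← add_zero (0 : ℝ)]
    nth_rewrite 1 [← hz 0 v0 h0]
    rw [← hz 1 v1 h1, ← integral_add (hcV 0 v0 h0) (hcV 1 v1 h1)]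
    congr 1; ext x
    rw [hcomp 0 v0 h0, hcomp 1 v1 h1]
    unfold lap
    linear_combination ζ x * β x ^ 2 * hdiv x
  · have := hβ.lap.continuous
    exact int_on (by fun_prop) hK
  · exact int_on (by fun_prop) hK
end

section
open MeasureTheory
open scoped ENNReal

lemma pt_term1 {ψ M b g p : ℝ} (h0 : 0 ≤ ψ) (h1 : ψ ≤ 1) (hp : |p| ≤ M) :
    - (2 * b * ((4 * ψ ^ 3 * p) * g)) ≤ (1 / 2) * (ψ ^ 4 * g ^ 2) + 32 * M ^ 2 * b ^ 2 := by
  have hp2 : p ^ 2 ≤ M ^ 2 := sq_le_sq' (by linarith [neg_abs_le p]) ((le_abs_self p).trans hp)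
  have hψ : ψ ^ 2 ≤ 1 := by nlinarith
  have h3 : ψ ^ 2 * (p ^ 2 * b ^ 2) ≤ 1 * (M ^ 2 * b ^ 2) := by gcongr
  nlinarith [sq_nonneg (ψ ^ 2 * g + 8 * (ψ * p * b))]

lemma pt_term2 {ψ M v p : ℝ} (hp : |p| ≤ M) :
    v * (4 * ψ ^ 3 * p) ≤ ψ ^ 2 * v ^ 2 * ψ ^ 4 + 4 * M ^ 2 := by
  have hp2 : p ^ 2 ≤ M ^ 2 := sq_le_sq' (by linarith [neg_abs_le p]) ((le_abs_self p).trans hp)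
  nlinarith [sq_nonneg (ψ ^ 3 * v - 2 * p)]

lemma pt_term3 {b : Fin 3 → ℝ} (i j : Fin 3) (s : ℝ) :
    2 * (b i * (b j * s)) ≤ 2 * ((∑ i, b i ^ 2) * |s|) := by
  have h1 : |b i * b j| ≤ ∑ i, b i ^ 2 := by
    have hi : b i ^ 2 ≤ ∑ i, b i ^ 2 :=
      Finset.single_le_sum (f := fun i => b i ^ 2) (fun _ _ => sq_nonneg _) (Finset.mem_univ i)
    have hj : b j ^ 2 ≤ ∑ i, b i ^ 2 :=
      Finset.single_le_sum (f := fun i => b i ^ 2) (fun _ _ => sq_nonneg _) (Finset.mem_univ j)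
    rw [abs_le]; constructor <;> nlinarith [sq_nonneg (b i - b j), sq_nonneg (b i + b j)]
  have : b i * (b j * s) ≤ |b i * b j| * |s| := by
    rw [← abs_mul, ← mul_assoc]; exact le_abs_self _
  nlinarith [mul_le_mul_of_nonneg_right h1 (abs_nonneg s)]

lemma pt_main {ψ M : ℝ} {b u : Fin 3 → ℝ} {g s : Fin 3 → Fin 2 → ℝ} {p : Fin 2 → ℝ}
    (h0 : 0 ≤ ψ) (h1 : ψ ≤ 1) (hp : ∀ k, |p k| ≤ M) :
    ∑ i, (-2 * ψ ^ 4 * (g i 0 ^ 2 + g i 1 ^ 2)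
        - 2 * b i * ((4 * ψ ^ 3 * p 0) * g i 0 + (4 * ψ ^ 3 * p 1) * g i 1)
        + b i ^ 2 * (u 0 * (4 * ψ ^ 3 * p 0) + u 1 * (4 * ψ ^ 3 * p 1))
        + ψ ^ 4 * (2 * b i * (b 0 * s i 0 + b 1 * s i 1)))
      ≤ -(3 / 2) * (ψ ^ 4 * ∑ i, ∑ k, g i k ^ 2) + 72 * M ^ 2 * ∑ i, b i ^ 2
        + (ψ ^ 4 * ∑ i, b i ^ 2) * (ψ ^ 2 * (∑ i, u i ^ 2) + 2 * ∑ i, ∑ k, |s i k|) := by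
  have hS : 0 ≤ ∑ i, b i ^ 2 := Finset.sum_nonneg fun _ _ => sq_nonneg _
  have hψ4 : 0 ≤ ψ ^ 4 := by positivity
  have t1 := fun i k => pt_term1 (b := b i) (g := g i k) h0 h1 (hp k)
  have t2 := fun i k => mul_le_mul_of_nonneg_left (pt_term2 (ψ := ψ) (v := u k.castSucc) (hp k))
    (sq_nonneg (b i))
  have t3 := fun i j k => mul_le_mul_of_nonneg_left (pt_term3 (b := b) i j (s i k)) hψ4
  have t4 : 0 ≤ ψ ^ 2 * u 2 ^ 2 * (ψ ^ 4 * ∑ i, b i ^ 2) := by positivity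
  have hA : ∑ i, (-2 * ψ ^ 4 * (g i 0 ^ 2 + g i 1 ^ 2)
        - 2 * b i * ((4 * ψ ^ 3 * p 0) * g i 0 + (4 * ψ ^ 3 * p 1) * g i 1)) 
      ≤ -(3 / 2) * (ψ ^ 4 * ∑ i, ∑ k, g i k ^ 2) + 64 * M ^ 2 * ∑ i, b i ^ 2 := by
    simp only [Fin.sum_univ_three, Fin.sum_univ_two]
    linarith [t1 0 0, t1 0 1, t1 1 0, t1 1 1, t1 2 0, t1 2 1]
  have hB : ∑ i, (b i ^ 2 * (u 0 * (4 * ψ ^ 3 * p 0) + u 1 * (4 * ψ ^ 3 * p 1)))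
      ≤ 8 * M ^ 2 * ∑ i, b i ^ 2 + (ψ ^ 4 * ∑ i, b i ^ 2) * (ψ ^ 2 * ∑ i, u i ^ 2) := by
    have c0 : (Fin.castSucc (0 : Fin 2)) = (0 : Fin 3) := rfl
    have c1 : (Fin.castSucc (1 : Fin 2)) = (1 : Fin 3) := rfl
    have a := fun i => t2 i 0
    have b := fun i => t2 i 1
    rw [c0] at a
    rw [c1] at b
    simp only [Fin.sum_univ_three] at t4 ⊢
    linarith [a 0, a 1, a 2, b 0, b 1, b 2]
  have hC : ∑ i, (ψ ^ 4 * (2 * b i * (b 0 * s i 0 + b 1 * s i 1)))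
      ≤ (ψ ^ 4 * ∑ i, b i ^ 2) * (2 * ∑ i, ∑ k, |s i k|) := by
    generalize (∑ i, b i ^ 2) = S at *
    simp only [Fin.sum_univ_three, Fin.sum_univ_two]
    linarith [t3 0 0 0, t3 1 0 0, t3 2 0 0, t3 0 1 1, t3 1 1 1, t3 2 1 1]
  rw [Finset.sum_add_distrib, Finset.sum_add_distrib]
  linarith

lemma pd_pow4 {ψ : R2 → ℝ} (hψ : Sm ψ) (k : Fin 2) (x : R2) :
    pd k (fun y => ψ y ^ 4) x = 4 * ψ x ^ 3 * pd k ψ x := by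
  have : (fun y => ψ y ^ 4) = fun y => (ψ y * ψ y) * (ψ y * ψ y) := by ext; ring
  rw [this, pd_mul (hψ.mul hψ) (hψ.mul hψ), pd_mul hψ hψ]; ring

lemma pd_sqmul {ψ β : R2 → ℝ} (hψ : Sm ψ) (hβ : Sm β) (k : Fin 2) (x : R2) :
    pd k (fun y => (ψ y * ψ y) * β y) x = 2 * ψ x * pd k ψ x * β x + ψ x ^ 2 * pd k β x := by
  rw [pd_mul (hψ.mul hψ) hβ, pd_mul hψ hψ]; ring

lemma tsupp_mul_sub {f g : R2 → ℝ} {K : Set R2} (h : tsupport f ⊆ K) :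
    tsupport (fun x => f x * g x) ⊆ K := (tsupport_mul_subset_left).trans h

lemma lady_w {ψ : R2 → ℝ} {B : Fin 3 → R2 → ℝ} {M : ℝ} {K : Set R2}
    (hψ : Sm ψ) (hB : ∀ i, Sm (B i)) (h0 : ∀ x, 0 ≤ ψ x) (h1 : ∀ x, ψ x ≤ 1)
    (hM : ∀ k x, |pd k ψ x| ≤ M) (hK : IsCompact K) (hs : tsupport ψ ⊆ K) :
    ∫ x in K, (ψ x ^ 4 * ∑ i, B i x ^ 2) ^ 2 ≤ 24 * ((∫ x in K, ψ x ^ 4 * ∑ i, B i x ^ 2) *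
      (2 * (∫ x in K, ψ x ^ 4 * ∑ i, ∑ k, (pd k (B i) x) ^ 2)
        + 16 * M ^ 2 * ∫ x in K, ∑ i, B i x ^ 2)) := by
  have cψ := hψ.continuous
  have cB := fun i => (hB i).continuous
  have cp := fun i k => ((hB i).pd k).continuous
  have cz := fun k => (hψ.pd k).continuous
  have L := vec_ladyzhenskaya (w := fun i y => (ψ y * ψ y) * B i y)
    (fun i => (hψ.mul hψ).mul (hB i)) hK (fun i => tsupp_mul_sub (tsupp_mul_sub hs))
  have e : ∀ x, ∑ i, ((ψ x * ψ x) * B i x) ^ 2 = ψ x ^ 4 * ∑ i, B i x ^ 2 := by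
    intro x; rw [Finset.mul_sum]; congr 1; ext i; ring
  simp only [e, pd_sqmul hψ (hB _)] at L
  refine L.trans ?_
  refine mul_le_mul_of_nonneg_left (mul_le_mul_of_nonneg_left ?_ (integral_nonneg fun x =>
    mul_nonneg (by positivity) (Finset.sum_nonneg fun _ _ => sq_nonneg _))) (by norm_num)
  rw [← integral_const_mul, ← integral_const_mul, ← integral_add (int_on (by fun_prop) hK)
    (int_on (by fun_prop) hK)]
  refine int_on_mono (by fun_prop) (by fun_prop) hK fun x => ?_
  have t : ∀ i k, (2 * ψ x * pd k ψ x * B i x + ψ x ^ 2 * pd k (B i) x) ^ 2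
      ≤ 2 * (ψ x ^ 4 * pd k (B i) x ^ 2) + 8 * M ^ 2 * B i x ^ 2 := by
    intro i k
    have hp2 : (pd k ψ x) ^ 2 ≤ M ^ 2 :=
      sq_le_sq' (by linarith [neg_abs_le (pd k ψ x), hM k x]) ((le_abs_self _).trans (hM k x))
    have hψ2 : ψ x ^ 2 ≤ 1 := by nlinarith [h0 x, h1 x]
    have h3 : ψ x ^ 2 * (pd k ψ x ^ 2 * B i x ^ 2) ≤ 1 * (M ^ 2 * B i x ^ 2) := by gcongr
    nlinarith [sq_nonneg (2 * ψ x * pd k ψ x * B i x - ψ x ^ 2 * pd k (B i) x)]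
  simp only [Fin.sum_univ_three, Fin.sum_univ_two]
  linarith [t 0 0, t 0 1, t 1 0, t 1 1, t 2 0, t 2 1]

lemma lady_v {ψ : R2 → ℝ} {B : Fin 3 → R2 → ℝ} {M : ℝ} {K : Set R2}
    (hψ : Sm ψ) (hB : ∀ i, Sm (B i)) (h0 : ∀ x, 0 ≤ ψ x) (h1 : ∀ x, ψ x ≤ 1)
    (hM : ∀ k x, |pd k ψ x| ≤ M) (hK : IsCompact K) (hs : tsupport ψ ⊆ K) :
    ∫ x in K, (ψ x ^ 2 * ∑ i, B i x ^ 2) ^ 2 ≤ 24 * ((∫ x in K, ∑ i, B i x ^ 2) *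
      (2 * (∫ x in K, ∑ i, ∑ k, (pd k (B i) x) ^ 2)
        + 4 * M ^ 2 * ∫ x in K, ∑ i, B i x ^ 2)) := by
  have cψ := hψ.continuous
  have cB := fun i => (hB i).continuous
  have cp := fun i k => ((hB i).pd k).continuous
  have cz := fun k => (hψ.pd k).continuous
  have L := vec_ladyzhenskaya (w := fun i y => ψ y * B i y)
    (fun i => hψ.mul (hB i)) hK (fun i => tsupp_mul_sub hs)
  have e : ∀ x, ∑ i, (ψ x * B i x) ^ 2 = ψ x ^ 2 * ∑ i, B i x ^ 2 := by
    intro x; rw [Finset.mul_sum]; congr 1; ext i; ring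
  simp only [e, pd_mul hψ (hB _)] at L
  refine L.trans ?_
  have hψ2 : ∀ x, ψ x ^ 2 ≤ 1 := fun x => by nlinarith [h0 x, h1 x]
  refine mul_le_mul_of_nonneg_left (mul_le_mul ?_ ?_ (integral_nonneg fun x =>
    Finset.sum_nonneg fun _ _ => Finset.sum_nonneg fun _ _ => sq_nonneg _)
    (integral_nonneg fun x => Finset.sum_nonneg fun _ _ => sq_nonneg _)) (by norm_num)
  · refine int_on_mono (by fun_prop) (by fun_prop) hK fun x => ?_
    exact mul_le_of_le_one_left (Finset.sum_nonneg fun _ _ => sq_nonneg _) (hψ2 x)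
  rw [← integral_const_mul, ← integral_const_mul, ← integral_add (int_on (by fun_prop) hK)
    (int_on (by fun_prop) hK)]
  refine int_on_mono (by fun_prop) (by fun_prop) hK fun x => ?_
  have t : ∀ i k, (pd k ψ x * B i x + ψ x * pd k (B i) x) ^ 2
      ≤ 2 * (pd k (B i) x ^ 2) + 2 * M ^ 2 * B i x ^ 2 := by
    intro i k
    have hp2 : (pd k ψ x) ^ 2 ≤ M ^ 2 :=
      sq_le_sq' (by linarith [neg_abs_le (pd k ψ x), hM k x]) ((le_abs_self _).trans (hM k x))
    have h3 : pd k ψ x ^ 2 * B i x ^ 2 ≤ M ^ 2 * B i x ^ 2 := by gcongr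
    have h4 : ψ x ^ 2 * pd k (B i) x ^ 2 ≤ 1 * pd k (B i) x ^ 2 := by gcongr; exact hψ2 x
    nlinarith [sq_nonneg (pd k ψ x * B i x - ψ x * pd k (B i) x)]
  simp only [Fin.sum_univ_three, Fin.sum_univ_two]
  linarith [t 0 0, t 0 1, t 1 0, t 1 1, t 2 0, t 2 1]

/-- The localized energy inequality at a fixed time. -/
lemma static_estimate {ψ : R2 → ℝ} {B u : Fin 3 → R2 → ℝ} {M : ℝ} {K : Set R2}
    (hψ : Sm ψ) (hB : ∀ i, Sm (B i)) (hu : ∀ i, Sm (u i))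
    (h0 : ∀ x, 0 ≤ ψ x) (h1 : ∀ x, ψ x ≤ 1)
    (hM : ∀ k x, |pd k ψ x| ≤ M) (hK : IsCompact K) (hs : tsupport ψ ⊆ K)
    (hdiv : ∀ x, pd 0 (u 0) x + pd 1 (u 1) x = 0) :
    ∫ x in K, ψ x ^ 4 * ∑ i, 2 * B i x * (lap (B i) x
        - (u 0 x * pd 0 (B i) x + u 1 x * pd 1 (B i) x)
        + (B 0 x * pd 0 (u i) x + B 1 x * pd 1 (u i) x))
      ≤ - (∫ x in K, ψ x ^ 4 * ∑ i, ∑ k, (pd k (B i) x) ^ 2)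
        + 24 * (48 * ((∫ x in K, ∑ i, u i x ^ 2) *
            (2 * (∫ x in K, ∑ i, ∑ k, (pd k (u i) x) ^ 2)
              + 4 * M ^ 2 * ∫ x in K, ∑ i, u i x ^ 2))
            + 48 * ∫ x in K, ∑ i, ∑ k, (pd k (u i) x) ^ 2)
          * (∫ x in K, ψ x ^ 4 * ∑ i, B i x ^ 2)
        + 76 * M ^ 2 * ∫ x in K, ∑ i, B i x ^ 2 := by
  have cψ := hψ.continuous
  have cB := fun i => (hB i).continuous
  have cu := fun i => (hu i).continuous
  have cp := fun i k => ((hB i).pd k).continuous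
  have cq := fun i k => ((hu i).pd k).continuous
  have cz := fun k => (hψ.pd k).continuous
  have cl := fun i => (hB i).lap.continuous
  have hζ : Sm (fun x => ψ x ^ 4) := hψ.pow 4
  have hζs : tsupport (fun x => ψ x ^ 4) ⊆ K := by
    have : (fun x => ψ x ^ 4) = fun x => ψ x * ψ x ^ 3 := by ext; ring
    rw [this]; exact tsupp_mul_sub hs
  have step1 : ∫ x in K, ψ x ^ 4 * ∑ i, 2 * B i x * (lap (B i) x
        - (u 0 x * pd 0 (B i) x + u 1 x * pd 1 (B i) x)
        + (B 0 x * pd 0 (u i) x + B 1 x * pd 1 (u i) x))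
      = ∫ x in K, ∑ i, (-2 * ψ x ^ 4 * (pd 0 (B i) x ^ 2 + pd 1 (B i) x ^ 2)
        - 2 * B i x * ((4 * ψ x ^ 3 * pd 0 ψ x) * pd 0 (B i) x
            + (4 * ψ x ^ 3 * pd 1 ψ x) * pd 1 (B i) x)
        + B i x ^ 2 * (u 0 x * (4 * ψ x ^ 3 * pd 0 ψ x) + u 1 x * (4 * ψ x ^ 3 * pd 1 ψ x))
        + ψ x ^ 4 * (2 * B i x * (B 0 x * pd 0 (u i) x + B 1 x * pd 1 (u i) x))) := by
    have e : ∀ x, ψ x ^ 4 * ∑ i, 2 * B i x * (lap (B i) x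
        - (u 0 x * pd 0 (B i) x + u 1 x * pd 1 (B i) x)
        + (B 0 x * pd 0 (u i) x + B 1 x * pd 1 (u i) x))
        = ∑ i, (ψ x ^ 4 * (2 * B i x * (lap (B i) x
        - (u 0 x * pd 0 (B i) x + u 1 x * pd 1 (B i) x)))
        + ψ x ^ 4 * (2 * B i x * (B 0 x * pd 0 (u i) x + B 1 x * pd 1 (u i) x))) := by
      intro x; rw [Finset.mul_sum]; congr 1; ext i; ring
    simp only [e]
    rw [integral_finsetSum _ (fun i _ => int_on (by fun_prop) hK),
      integral_finsetSum _ (fun i _ => int_on (by fun_prop) hK)]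
    congr 1; ext i
    rw [integral_add (int_on (by fun_prop) hK) (int_on (by fun_prop) hK),
      integral_add (int_on (by fun_prop) hK) (int_on (by fun_prop) hK)]
    congr 1
    rw [scalar_ibp hζ (hB i) (hu 0) (hu 1) hK hζs hdiv]
    simp only [pd_pow4 hψ]
  rw [step1]
  have step2 := int_on_mono (K := K) (f := fun x => ∑ i, (-2 * ψ x ^ 4 *
        (pd 0 (B i) x ^ 2 + pd 1 (B i) x ^ 2)
        - 2 * B i x * ((4 * ψ x ^ 3 * pd 0 ψ x) * pd 0 (B i) x
            + (4 * ψ x ^ 3 * pd 1 ψ x) * pd 1 (B i) x)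
        + B i x ^ 2 * (u 0 x * (4 * ψ x ^ 3 * pd 0 ψ x) + u 1 x * (4 * ψ x ^ 3 * pd 1 ψ x))
        + ψ x ^ 4 * (2 * B i x * (B 0 x * pd 0 (u i) x + B 1 x * pd 1 (u i) x))))
      (g := fun x => -(3 / 2) * (ψ x ^ 4 * ∑ i, ∑ k, pd k (B i) x ^ 2)
        + 72 * M ^ 2 * ∑ i, B i x ^ 2
        + (ψ x ^ 4 * ∑ i, B i x ^ 2) * (ψ x ^ 2 * (∑ i, u i x ^ 2)
          + 2 * ∑ i, ∑ k, |pd k (u i) x|))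
      (by fun_prop) (by fun_prop) hK
      (fun x => pt_main (b := fun i => B i x) (u := fun i => u i x)
        (g := fun i k => pd k (B i) x) (s := fun i k => pd k (u i) x) (p := fun k => pd k ψ x)
        (h0 x) (h1 x) (fun k => hM k x))
  refine step2.trans ?_
  rw [integral_add (int_on (by fun_prop) hK) (int_on (by fun_prop) hK),
    integral_add (int_on (by fun_prop) hK) (int_on (by fun_prop) hK),
    integral_const_mul, integral_const_mul]
  have C := cs_on (f := fun x => ψ x ^ 4 * ∑ i, B i x ^ 2)
    (g := fun x => ψ x ^ 2 * (∑ i, u i x ^ 2) + 2 * ∑ i, ∑ k, |pd k (u i) x|)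
    (by fun_prop) (by fun_prop) hK
  have Lw := lady_w hψ hB h0 h1 hM hK hs
  have Lv := lady_v hψ hu h0 h1 hM hK hs
  have P2 : ∫ x in K, (ψ x ^ 2 * (∑ i, u i x ^ 2) + 2 * ∑ i, ∑ k, |pd k (u i) x|) ^ 2
      ≤ 2 * (∫ x in K, (ψ x ^ 2 * ∑ i, u i x ^ 2) ^ 2)
        + 48 * ∫ x in K, ∑ i, ∑ k, (pd k (u i) x) ^ 2 := by
    rw [← integral_const_mul, ← integral_const_mul, ← integral_add (int_on (by fun_prop) hK)
      (int_on (by fun_prop) hK)]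
    refine int_on_mono (by fun_prop) (by fun_prop) hK fun x => ?_
    have q : (∑ i, ∑ k, |pd k (u i) x|) ^ 2 ≤ 6 * ∑ i, ∑ k, (pd k (u i) x) ^ 2 := by
      have := sq_sum_le_card_mul_sum_sq (s := (Finset.univ : Finset (Fin 3 × Fin 2)))
        (f := fun q => |pd q.2 (u q.1) x|)
      simp only [sq_abs, Finset.card_univ, Fintype.sum_prod_type, Fintype.card_prod,
        Fintype.card_fin] at this
      norm_num at this
      simpa only [Fin.sum_univ_two] using this
    nlinarith [sq_nonneg (ψ x ^ 2 * (∑ i, u i x ^ 2) - 2 * ∑ i, ∑ k, |pd k (u i) x|)]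
  have y0 : 0 ≤ ∫ x in K, ψ x ^ 4 * ∑ i, B i x ^ 2 := integral_nonneg fun x =>
    mul_nonneg (by positivity) (Finset.sum_nonneg fun _ _ => sq_nonneg _)
  have g0 : 0 ≤ ∫ x in K, ψ x ^ 4 * ∑ i, ∑ k, (pd k (B i) x) ^ 2 := integral_nonneg fun x =>
    mul_nonneg (by positivity) (Finset.sum_nonneg fun _ _ => Finset.sum_nonneg
      fun _ _ => sq_nonneg _)
  have m0 : 0 ≤ ∫ x in K, ∑ i, B i x ^ 2 := integral_nonneg fun x =>
    Finset.sum_nonneg fun _ _ => sq_nonneg _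
  have W0 : 0 ≤ ∫ x in K, (ψ x ^ 2 * (∑ i, u i x ^ 2) + 2 * ∑ i, ∑ k, |pd k (u i) x|) ^ 2 :=
    integral_nonneg fun x => sq_nonneg _
  generalize (∫ x in K, ψ x ^ 4 * ∑ i, B i x ^ 2) = y at *
  generalize (∫ x in K, ψ x ^ 4 * ∑ i, ∑ k, (pd k (B i) x) ^ 2) = g at *
  generalize (∫ x in K, ∑ i, B i x ^ 2) = m at *
  generalize (∫ x in K, ∑ i, u i x ^ 2) = e at *
  generalize (∫ x in K, ∑ i, ∑ k, (pd k (u i) x) ^ 2) = d at *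
  generalize (∫ x in K, (ψ x ^ 4 * ∑ i, B i x ^ 2) *
    (ψ x ^ 2 * (∑ i, u i x ^ 2) + 2 * ∑ i, ∑ k, |pd k (u i) x|)) = I at *
  generalize (∫ x in K, (ψ x ^ 4 * ∑ i, B i x ^ 2) ^ 2) = W2 at *
  generalize (∫ x in K, (ψ x ^ 2 * (∑ i, u i x ^ 2) + 2 * ∑ i, ∑ k, |pd k (u i) x|) ^ 2)
    = P at *
  obtain ⟨A, hA⟩ : ∃ A, A = 48 * (e * (2 * d + 4 * M ^ 2 * e)) + 48 * d := ⟨_, rfl⟩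
  have hPA : P ≤ A := by rw [hA]; linarith
  have A0 : 0 ≤ A := W0.trans hPA
  rw [← hA]
  obtain ⟨X, hX⟩ : ∃ X, X = 2 * g + 16 * M ^ 2 * m := ⟨_, rfl⟩
  have X0 : 0 ≤ X := by rw [hX]; positivity
  rw [← hX] at Lw
  have hI : I ^ 2 ≤ (24 * A * y) * X := by
    calc I ^ 2 ≤ W2 * P := C
      _ ≤ (24 * (y * X)) * A := by gcongr
      _ = _ := by ring
  have hI2 : I ≤ X / 4 + 24 * A * y := by
    have hZ : 0 ≤ 24 * A * y := by positivity
    refine (le_abs_self I).trans (abs_le_of_sq_le_sq (b := X / 4 + 24 * A * y) ?_ (by positivity))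
    nlinarith [sq_nonneg (X / 4 - 24 * A * y)]
  rw [hX] at hI2
  linarith
end

section
open MeasureTheory
open scoped ENNReal

lemma pd_lap {f : R2 → ℝ} (hf : Sm f) (k : Fin 2) (x : R2) :
    pd k (lap f) x = lap (pd k f) x := by
  have h : lap f = fun y => pd 0 (pd 0 f) y + pd 1 (pd 1 f) y := rfl
  have e : ∀ l, pd k (pd l (pd l f)) x = pd l (pd l (pd k f)) x := by
    intro l
    rw [pd_comm (hf.pd l) k l]
    have : pd k (pd l f) = pd l (pd k f) := funext fun y => pd_comm hf k l y
    rw [this]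
  rw [h, pd_add ((hf.pd 0).pd 0) ((hf.pd 1).pd 1), e, e]; rfl

lemma lap_add {f g : R2 → ℝ} (hf : Sm f) (hg : Sm g) (x : R2) :
    lap (fun y => f y + g y) x = lap f x + lap g x := by
  have e : ∀ k, pd k (fun y => f y + g y) = fun y => pd k f y + pd k g y :=
    fun k => funext fun y => pd_add hf hg k y
  unfold lap
  rw [e, e, pd_add (hf.pd 0) (hg.pd 0), pd_add (hf.pd 1) (hg.pd 1)]; ring

lemma lap_sub {f g : R2 → ℝ} (hf : Sm f) (hg : Sm g) (x : R2) :
    lap (fun y => f y - g y) x = lap f x - lap g x := by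
  have e : ∀ k, pd k (fun y => f y - g y) = fun y => pd k f y - pd k g y :=
    fun k => funext fun y => pd_sub hf hg k y
  unfold lap
  rw [e, e, pd_sub (hf.pd 0) (hg.pd 0), pd_sub (hf.pd 1) (hg.pd 1)]; ring

lemma lap_neg {f : R2 → ℝ} (x : R2) :
    lap (fun y => - f y) x = - lap f x := by
  have e : ∀ k, pd k (fun y => - f y) = fun y => - pd k f y :=
    fun k => funext fun y => pd_neg k y
  unfold lap
  rw [e, e, pd_neg, pd_neg]; ring

/-- planar advection of a scalar -/
noncomputable def adv (f0 f1 g : R2 → ℝ) (y : R2) : ℝ := f0 y * pd 0 g y + f1 y * pd 1 g y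

lemma Sm.adv {f0 f1 g : R2 → ℝ} (h0 : Sm f0) (h1 : Sm f1) (hg : Sm g) : Sm (adv f0 f1 g) :=
  (h0.mul (hg.pd 0)).add (h1.mul (hg.pd 1))

lemma pd_adv {f0 f1 g : R2 → ℝ} (h0 : Sm f0) (h1 : Sm f1) (hg : Sm g) (k : Fin 2) (x : R2) :
    pd k (adv f0 f1 g) x = pd k f0 x * pd 0 g x + f0 x * pd k (pd 0 g) x
      + (pd k f1 x * pd 1 g x + f1 x * pd k (pd 1 g) x) := by
  have : adv f0 f1 g = fun y => f0 y * pd 0 g y + f1 y * pd 1 g y := rfl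
  rw [this, pd_add (h0.mul (hg.pd 0)) (h1.mul (hg.pd 1)), pd_mul h0 (hg.pd 0),
    pd_mul h1 (hg.pd 1)]

lemma pd_mom {a0 a1 a c0 c1 c q : R2 → ℝ} (ha0 : Sm a0) (ha1 : Sm a1) (ha : Sm a)
    (hc0 : Sm c0) (hc1 : Sm c1) (hc : Sm c) (hq : Sm q) (k : Fin 2) (x : R2) :
    pd k (fun y => lap a y - adv a0 a1 a y - q y + adv c0 c1 c y) x
      = lap (pd k a) x - pd k (adv a0 a1 a) x - pd k q x + pd k (adv c0 c1 c) x := by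
  rw [pd_add ((ha.lap.sub (Sm.adv ha0 ha1 ha)).sub hq) (Sm.adv hc0 hc1 hc),
    pd_sub (ha.lap.sub (Sm.adv ha0 ha1 ha)) hq, pd_sub ha.lap (Sm.adv ha0 ha1 ha), pd_lap ha]

lemma pd_zero_fun (k : Fin 2) (x : R2) : pd k (fun _ => (0 : ℝ)) x = 0 := by
  unfold pd; simp

lemma curl_alg {U Bf N I : R2 → Fin 3 → ℝ} {p : R2 → ℝ}
    (hU : ∀ i, Sm (fun y => U y i)) (hB : ∀ i, Sm (fun y => Bf y i)) (hp : Sm p)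
    (dU : ∀ x, pd 0 (fun y => U y 0) x + pd 1 (fun y => U y 1) x = 0)
    (dB : ∀ x, pd 0 (fun y => Bf y 0) x + pd 1 (fun y => Bf y 1) x = 0)
    (hN : ∀ x, ∀ i : Fin 3, N x i + advect U U x i + ![pd 0 p x, pd 1 p x, 0] i
      = 1 * lap (fun y => U y i) x + advect Bf Bf x i)
    (hI : ∀ x, ∀ i : Fin 3, I x i + advect U Bf x i
      = 1 * lap (fun y => Bf y i) x + advect Bf U x i
        - 1 * curl (fun y => crossProduct (curl Bf y) (Bf y)) x i) (x : R2) (i : Fin 3) :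
    I x i + curl N x i = lap (fun y => Bf y i + curl U y i) x
      - (U x 0 * pd 0 (fun y => Bf y i + curl U y i) x
        + U x 1 * pd 1 (fun y => Bf y i + curl U y i) x)
      + ((Bf x 0 + curl U x 0) * pd 0 (fun y => U y i) x
        + (Bf x 1 + curl U x 1) * pd 1 (fun y => U y i) x) := by
  obtain ⟨a, ha⟩ : ∃ a : Fin 3 → R2 → ℝ, ∀ i, a i = fun y => U y i := ⟨_, fun _ => rfl⟩
  obtain ⟨c, hc⟩ : ∃ c : Fin 3 → R2 → ℝ, ∀ i, c i = fun y => Bf y i := ⟨_, fun _ => rfl⟩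
  have ea : ∀ i y, U y i = a i y := fun i y => by rw [ha]
  have ec : ∀ i y, Bf y i = c i y := fun i y => by rw [hc]
  simp only [← ha] at hU dU
  simp only [← hc] at hB dB
  have N0 : (fun y => N y 0) = fun y => lap (a 0) y - adv (a 0) (a 1) (a 0) y - pd 0 p y
      + adv (c 0) (c 1) (c 0) y := by
    ext y
    have := hN y 0
    simp only [advect, ← ha, ← hc, ea, ec, Matrix.cons_val_zero] at this
    simp only [adv]; linarith
  have N1 : (fun y => N y 1) = fun y => lap (a 1) y - adv (a 0) (a 1) (a 1) y - pd 1 p y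
      + adv (c 0) (c 1) (c 1) y := by
    ext y
    have := hN y 1
    simp only [advect, ← ha, ← hc, ea, ec, Matrix.cons_val_one, Matrix.cons_val_zero] at this
    simp only [adv]; linarith
  have N2 : (fun y => N y 2) = fun y => lap (a 2) y - adv (a 0) (a 1) (a 2) y - 0
      + adv (c 0) (c 1) (c 2) y := by
    ext y
    have := hN y 2
    simp only [advect, ← ha, ← hc, ea, ec, Matrix.cons_val] at this
    simp only [adv]; linarith
  have cN0 : curl N x 0 = lap (pd 1 (a 2)) x - pd 1 (adv (a 0) (a 1) (a 2)) x
      + pd 1 (adv (c 0) (c 1) (c 2)) x := by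
    change pd 1 (fun y => N y 2) x = _
    rw [N2, pd_mom (hU 0) (hU 1) (hU 2) (hB 0) (hB 1) (hB 2) contDiff_const, pd_zero_fun]; ring
  have cN1 : curl N x 1 = -(lap (pd 0 (a 2)) x - pd 0 (adv (a 0) (a 1) (a 2)) x
      + pd 0 (adv (c 0) (c 1) (c 2)) x) := by
    change -(pd 0 (fun y => N y 2) x) = _
    rw [N2, pd_mom (hU 0) (hU 1) (hU 2) (hB 0) (hB 1) (hB 2) contDiff_const, pd_zero_fun]; ring
  have cN2 : curl N x 2 = (lap (pd 0 (a 1)) x - pd 0 (adv (a 0) (a 1) (a 1)) x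
      + pd 0 (adv (c 0) (c 1) (c 1)) x) - (lap (pd 1 (a 0)) x - pd 1 (adv (a 0) (a 1) (a 0)) x
      + pd 1 (adv (c 0) (c 1) (c 0)) x) := by
    change pd 0 (fun y => N y 1) x - pd 1 (fun y => N y 0) x = _
    rw [N0, N1, pd_mom (hU 0) (hU 1) (hU 1) (hB 0) (hB 1) (hB 1) (hp.pd 1),
      pd_mom (hU 0) (hU 1) (hU 0) (hB 0) (hB 1) (hB 0) (hp.pd 0), pd_comm hp 1 0]; ring
  have J0 : ∀ y, crossProduct (curl Bf y) (Bf y) 0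
      = (- pd 0 (c 2) y) * c 2 y - (pd 0 (c 1) y - pd 1 (c 0) y) * c 1 y := by
    intro y; simp [cross_apply, curl, ← hc, ec]
  have J1 : ∀ y, crossProduct (curl Bf y) (Bf y) 1
      = (pd 0 (c 1) y - pd 1 (c 0) y) * c 0 y - pd 1 (c 2) y * c 2 y := by
    intro y; simp [cross_apply, curl, ← hc, ec]
  have J2 : ∀ y, crossProduct (curl Bf y) (Bf y) 2
      = adv (c 0) (c 1) (c 2) y := by
    intro y; simp [cross_apply, curl, ← hc, ec, adv]; ring
  have hv := hI x i
  have dU0 := dU x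
  have dB0 := dB x
  have dB' : ∀ k, pd k (pd 0 (c 0)) x + pd k (pd 1 (c 1)) x = 0 := by
    intro k
    rw [← pd_add ((hB 0).pd 0) ((hB 1).pd 1)]
    have : (fun y => pd 0 (c 0) y + pd 1 (c 1) y) = fun _ => 0 := funext dB
    rw [this, pd_zero_fun]
  have dU' : ∀ k, pd k (pd 0 (a 0)) x + pd k (pd 1 (a 1)) x = 0 := by
    intro k
    rw [← pd_add ((hU 0).pd 0) ((hU 1).pd 1)]
    have : (fun y => pd 0 (a 0) y + pd 1 (a 1) y) = fun _ => 0 := funext dU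
    rw [this, pd_zero_fun]
  have ka := fun i => pd_comm (hU i) 1 0 x
  have kc := fun i => pd_comm (hB i) 1 0 x
  simp only [advect, one_mul] at hv
  fin_cases i
  · have h1 : (fun y => Bf y 0 + curl U y 0) = fun y => c 0 y + pd 1 (a 2) y := by
      simp only [ha, hc]; rfl
    have h2 : curl (fun y => crossProduct (curl Bf y) (Bf y)) x 0
        = pd 1 (adv (c 0) (c 1) (c 2)) x := by
      change pd 1 (fun y => crossProduct (curl Bf y) (Bf y) 2) x = _
      simp only [J2]
    have h3 : curl U x 0 = pd 1 (a 2) x := by rw [ha]; rfl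
    have h4 : curl U x 1 = - pd 0 (a 2) x := by rw [ha]; rfl
    simp only [Fin.zero_eta, h1, h3, h4, cN0] at hv ⊢
    rw [h2] at hv
    simp only [← ha, ← hc, ea, ec] at hv ⊢
    rw [lap_add (hB 0) ((hU 2).pd 1), pd_add (hB 0) ((hU 2).pd 1), pd_add (hB 0) ((hU 2).pd 1),
      pd_adv (hU 0) (hU 1) (hU 2)]
    simp only [ka, kc]
    linear_combination hv - pd 1 (a 2) x * dU0
  · have h1 : (fun y => Bf y 1 + curl U y 1) = fun y => c 1 y + (- pd 0 (a 2) y) := by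
      simp only [ha, hc]; rfl
    have h2 : curl (fun y => crossProduct (curl Bf y) (Bf y)) x 1
        = - pd 0 (adv (c 0) (c 1) (c 2)) x := by
      change -(pd 0 (fun y => crossProduct (curl Bf y) (Bf y) 2) x) = _
      simp only [J2]
    have h3 : curl U x 0 = pd 1 (a 2) x := by rw [ha]; rfl
    have h4 : curl U x 1 = - pd 0 (a 2) x := by rw [ha]; rfl
    simp only [Fin.mk_one, h1, h3, h4, cN1] at hv ⊢
    rw [h2] at hv
    simp only [← ha, ← hc, ea, ec] at hv ⊢
    rw [lap_add (hB 1) ((hU 2).pd 0).neg, pd_add (hB 1) ((hU 2).pd 0).neg,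
      pd_add (hB 1) ((hU 2).pd 0).neg, lap_neg, pd_neg, pd_neg,
      pd_adv (hU 0) (hU 1) (hU 2)]
    simp only [ka, kc]
    linear_combination hv + pd 0 (a 2) x * dU0
  · have h1 : (fun y => Bf y 2 + curl U y 2) = fun y => c 2 y + (pd 0 (a 1) y - pd 1 (a 0) y) := by
      simp only [ha, hc]; rfl
    have h2 : curl (fun y => crossProduct (curl Bf y) (Bf y)) x 2
        = pd 0 (fun y => (pd 0 (c 1) y - pd 1 (c 0) y) * c 0 y - pd 1 (c 2) y * c 2 y) x
          - pd 1 (fun y => (- pd 0 (c 2) y) * c 2 y - (pd 0 (c 1) y - pd 1 (c 0) y) * c 1 y) x := by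
      change pd 0 (fun y => crossProduct (curl Bf y) (Bf y) 1) x
        - pd 1 (fun y => crossProduct (curl Bf y) (Bf y) 0) x = _
      simp only [J0, J1]
    have hj : Sm (fun y => pd 0 (c 1) y - pd 1 (c 0) y) := ((hB 1).pd 0).sub ((hB 0).pd 1)
    rw [pd_sub (hj.mul (hB 0)) (((hB 2).pd 1).mul (hB 2)),
      pd_sub (((hB 2).pd 0).neg.mul (hB 2)) (hj.mul (hB 1)), pd_mul hj (hB 0), pd_mul hj (hB 1),
      pd_mul ((hB 2).pd 1) (hB 2), pd_mul ((hB 2).pd 0).neg (hB 2), pd_neg,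
      pd_sub ((hB 1).pd 0) ((hB 0).pd 1), pd_sub ((hB 1).pd 0) ((hB 0).pd 1)] at h2
    have h3 : curl U x 0 = pd 1 (a 2) x := by rw [ha]; rfl
    have h4 : curl U x 1 = - pd 0 (a 2) x := by rw [ha]; rfl
    simp only [Fin.reduceFinMk, h1, h3, h4, cN2] at hv ⊢
    rw [h2] at hv
    simp only [← ha, ← hc, ea, ec] at hv ⊢
    have hw := ((hU 1).pd 0).sub ((hU 0).pd 1)
    rw [lap_add (hB 2) hw, pd_add (hB 2) hw, pd_add (hB 2) hw,
      lap_sub ((hU 1).pd 0) ((hU 0).pd 1), pd_sub ((hU 1).pd 0) ((hU 0).pd 1),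
      pd_sub ((hU 1).pd 0) ((hU 0).pd 1),
      pd_adv (hU 0) (hU 1) (hU 1), pd_adv (hU 0) (hU 1) (hU 0),
      pd_adv (hB 0) (hB 1) (hB 1), pd_adv (hB 0) (hB 1) (hB 0)]
    have e0 := dB' 0
    have e1 := dB' 1
    simp only [ka, kc] at hv e0 e1 ⊢
    linear_combination hv - (pd 0 (a 1) x - pd 1 (a 0) x) * dU0
end

section
open MeasureTheory Set

/-- The space-time slab. -/
abbrev Slab (T : ℝ) : Set (ℝ × R2) := Icc 0 T ×ˢ univ

/-- Joint smoothness on the slab. -/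
abbrev SmT (T : ℝ) (F : ℝ → R2 → ℝ) : Prop :=
  ContDiffOn ℝ (⊤ : ℕ∞) (fun p : ℝ × R2 => F p.1 p.2) (Slab T)

lemma slab_udiff {T : ℝ} (hT : 0 < T) : UniqueDiffOn ℝ (Slab T) :=
  (uniqueDiffOn_Icc hT).prod uniqueDiffOn_univ

lemma slab_nhds {T t : ℝ} (ht : t ∈ Ioo 0 T) (x : R2) : Slab T ∈ nhds (t, x) :=
  prod_mem_nhds (Icc_mem_nhds ht.1 ht.2) Filter.univ_mem

/-- Time derivative within the slab. -/
noncomputable def Dt (T : ℝ) (F : ℝ → R2 → ℝ) (t : ℝ) (x : R2) : ℝ :=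
  fderivWithin ℝ (fun p : ℝ × R2 => F p.1 p.2) (Slab T) (t, x) (1, 0)

lemma SmT.diffOn {T : ℝ} {F : ℝ → R2 → ℝ} (hF : SmT T F) :
    DifferentiableOn ℝ (fun p : ℝ × R2 => F p.1 p.2) (Slab T) :=
  hF.differentiableOn (by simp)

lemma SmT.slice {T : ℝ} {F : ℝ → R2 → ℝ} (hF : SmT T F) {t : ℝ} (ht : t ∈ Icc 0 T) :
    Sm (F t) := by
  have h : ContDiffOn ℝ (⊤ : ℕ∞) (fun x : R2 => ((t, x) : ℝ × R2)) univ :=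
    (contDiff_prodMk_right t).contDiffOn
  have := hF.comp h (fun x _ => ⟨ht, mem_univ _⟩)
  exact contDiffOn_univ.1 this

lemma SmT.hasFDeriv_slice {T : ℝ} {F : ℝ → R2 → ℝ} (hF : SmT T F) {t : ℝ} (ht : t ∈ Icc 0 T)
    (x : R2) : HasFDerivAt (F t) ((fderivWithin ℝ (fun p : ℝ × R2 => F p.1 p.2) (Slab T) (t, x)).comp
      (ContinuousLinearMap.inr ℝ ℝ R2)) x := by
  have h1 := (hF.diffOn (t, x) ⟨ht, mem_univ _⟩).hasFDerivWithinAt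
  have h2 : HasFDerivWithinAt (fun y : R2 => ((t, y) : ℝ × R2))
      (ContinuousLinearMap.inr ℝ ℝ R2) univ x := (hasFDerivAt_prodMk_right t x).hasFDerivWithinAt
  have := h1.comp x h2 (fun y _ => ⟨ht, mem_univ _⟩)
  exact hasFDerivWithinAt_univ.1 this

lemma SmT.pd_eq {T : ℝ} {F : ℝ → R2 → ℝ} (hF : SmT T F) {t : ℝ} (ht : t ∈ Icc 0 T)
    (x : R2) (k : Fin 2) : pd k (F t) x =
      fderivWithin ℝ (fun p : ℝ × R2 => F p.1 p.2) (Slab T) (t, x) (0, Pi.single k 1) := by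
  unfold pd
  rw [(hF.hasFDeriv_slice ht x).fderiv]; simp

lemma SmT.pd {T : ℝ} (hT : 0 < T) {F : ℝ → R2 → ℝ} (hF : SmT T F) (k : Fin 2) :
    SmT T (fun t => pd k (F t)) := by
  have h := (hF.fderivWithin (m := (⊤ : ℕ∞)) (slab_udiff hT) (by exact_mod_cast le_top)).clm_apply
    (contDiffOn_const (c := ((0, Pi.single k 1) : ℝ × R2)))
  exact h.congr (fun p hp => hF.pd_eq hp.1 p.2 k)

lemma SmT.dt {T : ℝ} (hT : 0 < T) {F : ℝ → R2 → ℝ} (hF : SmT T F) :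
    SmT T (Dt T F) :=
  (hF.fderivWithin (m := (⊤ : ℕ∞)) (slab_udiff hT) (by exact_mod_cast le_top)).clm_apply
    (contDiffOn_const (c := ((1, 0) : ℝ × R2)))

lemma SmT.hasDerivAt {T : ℝ} {F : ℝ → R2 → ℝ} (hF : SmT T F) {t : ℝ} (ht : t ∈ Ioo 0 T)
    (x : R2) : HasDerivAt (fun s => F s x) (Dt T F t x) t := by
  have h1 := (hF.diffOn (t, x) ⟨Ioo_subset_Icc_self ht, mem_univ _⟩).hasFDerivWithinAt.hasFDerivAt
    (slab_nhds ht x)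
  have h2 : HasDerivAt (fun s : ℝ => ((s, x) : ℝ × R2)) (1, 0) t :=
    (hasDerivAt_id t).prodMk (hasDerivAt_const t x)
  exact h1.comp_hasDerivAt t h2

lemma SmT.dt_pd {T : ℝ} (hT : 0 < T) {F : ℝ → R2 → ℝ} (hF : SmT T F) {t : ℝ} (ht : t ∈ Ioo 0 T)
    (x : R2) (k : Fin 2) : Dt T (fun s => _root_.pd k (F s)) t x = _root_.pd k (Dt T F t) x := by
  have htc := Ioo_subset_Icc_self ht
  set G : ℝ × R2 → ℝ := fun p => F p.1 p.2 with hG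
  have hn := slab_nhds ht x
  have hS : ∀ᶠ q in nhds ((t, x) : ℝ × R2), Slab T ∈ nhds q := eventually_mem_nhds_iff.2 hn
  have hC : ContDiffAt ℝ (⊤ : ℕ∞) G (t, x) := hF.contDiffAt hn
  have hd : DifferentiableAt ℝ (fderiv ℝ G) (t, x) :=
    (hC.fderiv_right (m := (⊤ : ℕ∞)) (by exact_mod_cast le_top)).differentiableAt (by simp)
  have e1 : (fun p : ℝ × R2 => _root_.pd k (F p.1) p.2) =ᶠ[nhds (t, x)]
      fun q => fderiv ℝ G q (0, Pi.single k 1) := by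
    filter_upwards [hS] with q hq
    rw [hF.pd_eq (mem_of_mem_nhds hq).1, ← fderivWithin_of_mem_nhds hq]
  have e2 : (fun p : ℝ × R2 => Dt T F p.1 p.2) =ᶠ[nhds (t, x)]
      fun q => fderiv ℝ G q (1, 0) := by
    filter_upwards [hS] with q hq
    unfold Dt
    rw [← fderivWithin_of_mem_nhds hq]
  rw [(hF.dt hT).pd_eq htc]
  unfold Dt at e2 ⊢
  rw [fderivWithin_of_mem_nhds hn, fderivWithin_of_mem_nhds hn, e1.fderiv_eq, e2.fderiv_eq]
  rw [fderiv_clm_apply hd (by fun_prop), fderiv_clm_apply hd (by fun_prop)]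
  have := hC.isSymmSndFDerivAt (by simp; exact WithTop.coe_le_coe.2 (le_top : (2 : ℕ∞) ≤ ⊤)) (1, 0) (0, Pi.single k 1)
  simpa using this

/-- continuity of parametric integrals over compact sets -/
lemma cont_int {T : ℝ} (hT : 0 < T) {F : ℝ → R2 → ℝ}
    (hF : ContinuousOn (fun p : ℝ × R2 => F p.1 p.2) (Slab T)) {K : Set R2} (hK : IsCompact K) :
    ContinuousOn (fun t => ∫ x in K, F t x) (Icc 0 T) := by
  have h1 : Continuous (fun p : ℝ × R2 => F (projIcc 0 T hT.le p.1) p.2) := by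
    have h2 : Continuous (fun p : ℝ × R2 => (((projIcc 0 T hT.le p.1 : ℝ), p.2) : ℝ × R2)) := by
      fun_prop
    exact hF.comp_continuous h2 (fun p => ⟨(projIcc 0 T hT.le p.1).2, mem_univ _⟩)
  have h3 := continuous_parametric_integral_of_continuous (μ := volume)
    (f := fun t x => F (projIcc 0 T hT.le t) x) h1 hK
  refine h3.continuousOn.congr fun t ht => ?_
  simp only [projIcc_of_mem hT.le ht]

lemma deriv_int {T : ℝ} (hT : 0 < T) {F : ℝ → R2 → ℝ} (hF : SmT T F)
    {K : Set R2} (hK : IsCompact K) {t : ℝ} (ht : t ∈ Ioo 0 T) :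
    HasDerivAt (fun t => ∫ x in K, F t x) (∫ x in K, Dt T F t x) t := by
  have hD := (hF.dt hT)
  obtain ⟨C, hC⟩ := (isCompact_Icc.prod hK).exists_bound_of_continuousOn
    (hD.continuousOn.mono (prod_mono (le_refl (Icc 0 T)) (subset_univ K)))
  refine (hasDerivAt_integral_of_dominated_loc_of_deriv_le (μ := volume.restrict K)
    (F := F) (F' := Dt T F) (bound := fun _ => C) (s := Ioo 0 T) (Ioo_mem_nhds ht.1 ht.2)
    ?_ ?_ ?_ ?_ ?_ ?_).2
  · filter_upwards [Ioo_mem_nhds ht.1 ht.2] with s hs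
    exact (hF.slice (Ioo_subset_Icc_self hs)).continuous.aestronglyMeasurable
  · exact int_on (hF.slice (Ioo_subset_Icc_self ht)).continuous hK
  · exact (hD.slice (Ioo_subset_Icc_self ht)).continuous.aestronglyMeasurable
  · filter_upwards [ae_restrict_mem hK.measurableSet] with x hx s hs
    exact hC (s, x) ⟨Ioo_subset_Icc_self hs, hx⟩
  · exact integrableOn_const hK.measure_lt_top.ne
  · filter_upwards with x s hs
    exact hF.hasDerivAt hs x
end

section
open MeasureTheory Set

lemma gronwall_aux {T : ℝ} (hT : 0 < T) {y g a c : ℝ → ℝ} (hy : ContinuousOn y (Icc 0 T))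
    (hg : Continuous g) (ha : Continuous a) (hc : Continuous c)
    (g0 : ∀ t, 0 ≤ g t) (a0 : ∀ t, 0 ≤ a t) (c0 : ∀ t, 0 ≤ c t)
    (hd : ∀ t ∈ Ioo 0 T, ∃ y', HasDerivAt y y' t ∧ y' ≤ - g t + a t * y t + c t) {t : ℝ}
    (ht : t ∈ Icc 0 T) :
    (y t + ∫ s in (0:ℝ)..t, g s) * Real.exp (- ∫ s in (0:ℝ)..t, a s)
      ≤ y 0 + ∫ s in (0:ℝ)..t, c s := by
  have dg : ∀ t, HasDerivAt (fun t => ∫ s in (0:ℝ)..t, g s) (g t) t := fun t =>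
    (hg.integral_hasStrictDerivAt 0 t).hasDerivAt
  have da : ∀ t, HasDerivAt (fun t => ∫ s in (0:ℝ)..t, a s) (a t) t := fun t =>
    (ha.integral_hasStrictDerivAt 0 t).hasDerivAt
  have dc : ∀ t, HasDerivAt (fun t => ∫ s in (0:ℝ)..t, c s) (c t) t := fun t =>
    (hc.integral_hasStrictDerivAt 0 t).hasDerivAt
  have cg : Continuous (fun t => ∫ s in (0:ℝ)..t, g s) :=
    continuous_iff_continuousAt.2 fun t => (dg t).continuousAt
  have ca : Continuous (fun t => ∫ s in (0:ℝ)..t, a s) :=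
    continuous_iff_continuousAt.2 fun t => (da t).continuousAt
  have cc : Continuous (fun t => ∫ s in (0:ℝ)..t, c s) :=
    continuous_iff_continuousAt.2 fun t => (dc t).continuousAt
  have anti : AntitoneOn (fun t => (y t + ∫ s in (0:ℝ)..t, g s) *
      Real.exp (- ∫ s in (0:ℝ)..t, a s) - ∫ s in (0:ℝ)..t, c s) (Icc 0 T) := by
    have hder : ∀ t ∈ Ioo 0 T, ∃ z', HasDerivAt (fun t => (y t + ∫ s in (0:ℝ)..t, g s) *
      Real.exp (- ∫ s in (0:ℝ)..t, a s) - ∫ s in (0:ℝ)..t, c s) z' t ∧ z' ≤ 0 := by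
      intro t ht
      obtain ⟨y', h1, h2⟩ := hd t ht
      refine ⟨_, ((h1.add (dg t)).mul (da t).neg.exp).sub (dc t), ?_⟩
      have hG : 0 ≤ ∫ s in (0:ℝ)..t, g s :=
        intervalIntegral.integral_nonneg ht.1.le (fun s _ => g0 s)
      have hA : 0 ≤ ∫ s in (0:ℝ)..t, a s :=
        intervalIntegral.integral_nonneg ht.1.le (fun s _ => a0 s)
      have he : Real.exp (- ∫ s in (0:ℝ)..t, a s) ≤ 1 := Real.exp_le_one_iff.2 (by linarith)
      have he0 := Real.exp_pos (- ∫ s in (0:ℝ)..t, a s)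
      simp only [Pi.add_apply, Pi.neg_apply]
      have h3 : y' + g t - a t * (y t + ∫ s in (0:ℝ)..t, g s) ≤ c t := by
        have := mul_nonneg (a0 t) hG
        nlinarith
      have h4 := mul_le_mul_of_nonneg_right h3 he0.le
      have h5 := mul_le_mul_of_nonneg_left he (c0 t)
      nlinarith
    refine antitoneOn_of_deriv_nonpos (convex_Icc 0 T) ?_ ?_ ?_
    · exact ((hy.add cg.continuousOn).mul (Real.continuous_exp.comp ca.neg).continuousOn).sub
        cc.continuousOn
    · rw [interior_Icc]
      intro t ht
      obtain ⟨z', h1, -⟩ := hder t ht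
      exact h1.differentiableAt.differentiableWithinAt
    · rw [interior_Icc]
      intro t ht
      obtain ⟨z', h1, h2⟩ := hder t ht
      rw [h1.deriv]; exact h2
  have := anti (left_mem_Icc.2 hT.le) ht ht.1
  simp at this
  linarith

lemma gronwall {T : ℝ} (hT : 0 < T) {y g a c : ℝ → ℝ} (hy : ContinuousOn y (Icc 0 T))
    (hg : ContinuousOn g (Icc 0 T)) (ha : ContinuousOn a (Icc 0 T))
    (hc : ContinuousOn c (Icc 0 T)) (y0 : ∀ t ∈ Icc 0 T, 0 ≤ y t)
    (g0 : ∀ t ∈ Icc 0 T, 0 ≤ g t) (a0 : ∀ t ∈ Icc 0 T, 0 ≤ a t) (c0 : ∀ t ∈ Icc 0 T, 0 ≤ c t)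
    (hd : ∀ t ∈ Ioo 0 T, ∃ y', HasDerivAt y y' t ∧ y' ≤ - g t + a t * y t + c t)
    {A C : ℝ} (hA : ∫ s in Icc 0 T, a s ≤ A) (hC : ∫ s in Icc 0 T, c s ≤ C) :
    (∀ t ∈ Icc 0 T, y t ≤ Real.exp A * (y 0 + C)) ∧
      ∫ s in Icc 0 T, g s ≤ Real.exp A * (y 0 + C) := by
  have ext : ∀ {f : ℝ → ℝ}, ContinuousOn f (Icc 0 T) → (∀ t ∈ Icc 0 T, 0 ≤ f t) →
      ∃ f' : ℝ → ℝ, Continuous f' ∧ (∀ t, 0 ≤ f' t) ∧ ∀ t ∈ Icc 0 T, f' t = f t := by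
    intro f h1 h2
    refine ⟨fun t => f (projIcc 0 T hT.le t), h1.comp_continuous (by fun_prop)
      (fun t => (projIcc 0 T hT.le t).2), fun t => h2 _ (projIcc 0 T hT.le t).2, fun t ht => ?_⟩
    simp only [projIcc_of_mem hT.le ht]
  obtain ⟨g', gc, gp, ge⟩ := ext hg g0
  obtain ⟨a', ac, ap, ae⟩ := ext ha a0
  obtain ⟨c', cc, cp, ce⟩ := ext hc c0
  have key := fun t (ht : t ∈ Icc 0 T) => gronwall_aux hT hy gc ac cc gp ap cp (fun t ht => by
    have h := Ioo_subset_Icc_self ht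
    rw [ge t h, ae t h, ce t h]; exact hd t ht) ht
  have conv : ∀ {f f' : ℝ → ℝ}, (∀ t ∈ Icc 0 T, f' t = f t) →
      ∫ s in Icc 0 T, f s = ∫ s in (0:ℝ)..T, f' s := by
    intro f f' h
    rw [intervalIntegral.integral_of_le hT.le, ← integral_Icc_eq_integral_Ioc]
    exact setIntegral_congr_fun measurableSet_Icc (fun t ht => (h t ht).symm)
  rw [conv ae] at hA
  rw [conv ce] at hC
  rw [conv ge]
  have mono : ∀ {f : ℝ → ℝ}, Continuous f → (∀ t, 0 ≤ f t) → ∀ t ∈ Icc 0 T,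
      ∫ s in (0:ℝ)..t, f s ≤ ∫ s in (0:ℝ)..T, f s := by
    intro f h1 h2 t ht
    exact intervalIntegral.integral_mono_interval le_rfl ht.1 ht.2
      (Filter.Eventually.of_forall h2) (h1.intervalIntegrable _ _)
  have main : ∀ t ∈ Icc 0 T, y t + ∫ s in (0:ℝ)..t, g' s ≤ Real.exp A * (y 0 + C) := by
    intro t ht
    have h1 := key t ht
    have h2 := mono ac ap t ht
    have h3 := mono cc cp t ht
    have h4 : 0 ≤ y t + ∫ s in (0:ℝ)..t, g' s :=
      add_nonneg (y0 t ht) (intervalIntegral.integral_nonneg ht.1 (fun s _ => gp s))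
    have h5 : Real.exp (-A) ≤ Real.exp (- ∫ s in (0:ℝ)..t, a' s) :=
      Real.exp_le_exp.2 (by linarith)
    have h6 := mul_le_mul_of_nonneg_left h5 h4
    have h7 : (y t + ∫ s in (0:ℝ)..t, g' s) * Real.exp (-A) ≤ y 0 + C := by linarith
    have h8 := mul_le_mul_of_nonneg_left h7 (Real.exp_pos A).le
    rw [mul_comm (y t + _), ← mul_assoc, ← Real.exp_add] at h8
    simpa using h8
  refine ⟨fun t ht => ?_, ?_⟩
  · have := intervalIntegral.integral_nonneg (f := g') (μ := volume) ht.1 (fun s _ => gp s)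
    linarith [main t ht]
  · linarith [main T (right_mem_Icc.2 hT.le), y0 T (right_mem_Icc.2 hT.le)]
end

section
open MeasureTheory Set

lemma SmT.congr' {T : ℝ} {F G : ℝ → R2 → ℝ} (hF : SmT T F)
    (h : ∀ t x, G t x = F t x) : SmT T G :=
  ContDiffOn.congr hF (fun p _ => h p.1 p.2)

lemma smT_curl {T : ℝ} (hT : 0 < T) {u : ℝ → R2 → Fin 3 → ℝ}
    (hu : ∀ i, SmT T (fun t x => u t x i)) (i : Fin 3) : SmT T (fun t x => curl (u t) x i) := by
  fin_cases i
  · exact (hu 2).pd hT 1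
  · exact ((hu 2).pd hT 0).neg
  · exact ((hu 1).pd hT 0).sub ((hu 0).pd hT 1)

lemma dt_curl {T : ℝ} (hT : 0 < T) {u : ℝ → R2 → Fin 3 → ℝ}
    (hu : ∀ i, SmT T (fun t x => u t x i)) {t : ℝ} (ht : t ∈ Ioo 0 T) (x : R2) (i : Fin 3) :
    HasDerivAt (fun s => curl (u s) x i)
      (curl (fun y j => Dt T (fun s z => u s z j) t y) x i) t := by
  have key : ∀ (j : Fin 3) (k : Fin 2), HasDerivAt (fun s => pd k (fun y => u s y j) x)
      (pd k (fun y => Dt T (fun s z => u s z j) t y) x) t := by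
    intro j k
    have h := ((hu j).pd hT k).hasDerivAt ht x
    rw [(hu j).dt_pd hT ht x k] at h
    exact h
  fin_cases i
  · exact key 2 1
  · exact (key 2 0).neg
  · exact (key 1 0).sub (key 0 1)

section
variable {T : ℝ} {u b : ℝ → R2 → Fin 3 → ℝ} {π : ℝ → R2 → ℝ}

lemma sol_u (hsol : IsHallMHDSolution 1 1 1 (Icc 0 T) u b π) (i : Fin 3) :
    SmT T (fun t x => u t x i) := contDiffOn_pi.1 hsol.smooth_u i

lemma sol_b (hsol : IsHallMHDSolution 1 1 1 (Icc 0 T) u b π) (i : Fin 3) :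
    SmT T (fun t x => b t x i) := contDiffOn_pi.1 hsol.smooth_b i

lemma sol_B (hT : 0 < T) (hsol : IsHallMHDSolution 1 1 1 (Icc 0 T) u b π) (i : Fin 3) :
    SmT T (fun t x => b t x i + curl (u t) x i) :=
  (sol_b hsol i).add (smT_curl hT (sol_u hsol) i)

lemma B_eq (hT : 0 < T) (hsol : IsHallMHDSolution 1 1 1 (Icc 0 T) u b π) {t : ℝ}
    (ht : t ∈ Ioo 0 T) (x : R2) (i : Fin 3) :
    HasDerivAt (fun s => b s x i + curl (u s) x i)
      (lap (fun y => b t y i + curl (u t) y i) x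
      - (u t x 0 * pd 0 (fun y => b t y i + curl (u t) y i) x
        + u t x 1 * pd 1 (fun y => b t y i + curl (u t) y i) x)
      + ((b t x 0 + curl (u t) x 0) * pd 0 (fun y => u t y i) x
        + (b t x 1 + curl (u t) x 1) * pd 1 (fun y => u t y i) x)) t := by
  have htc := Ioo_subset_Icc_self ht
  rw [← curl_alg (U := u t) (Bf := b t) (N := fun y j => Dt T (fun s z => u s z j) t y)
    (I := fun y j => Dt T (fun s z => b s z j) t y) (p := π t)
    (fun i => (sol_u hsol i).slice htc) (fun i => (sol_b hsol i).slice htc)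
    (hsol.schwartz_pi t htc).1 (hsol.div_u t htc) (hsol.div_b t htc)
    (fun x i => by
      have := hsol.momentum t htc x i
      rw [((sol_u hsol i).hasDerivAt ht x).deriv] at this
      exact this)
    (fun x i => by
      have := hsol.induction t htc x i
      rw [((sol_b hsol i).hasDerivAt ht x).deriv] at this
      exact this)]
  exact ((sol_b hsol i).hasDerivAt ht x).add (dt_curl hT (sol_u hsol) ht x i)

lemma smT_const {ψ : R2 → ℝ} (hψ : Sm ψ) : SmT T (fun _ x => ψ x) :=
  (hψ.comp contDiff_snd).contDiffOn

lemma smT_y (hT : 0 < T) (hsol : IsHallMHDSolution 1 1 1 (Icc 0 T) u b π) {ψ : R2 → ℝ}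
    (hψ : Sm ψ) : SmT T (fun t x => ψ x ^ 4 * ∑ i, (b t x i + curl (u t) x i) ^ 2) := by
  have h : ContDiffOn ℝ (⊤ : ℕ∞)
    (fun p : ℝ × R2 => ∑ i, (b p.1 p.2 i + curl (u p.1) p.2 i) ^ 2) (Slab T) :=
    ContDiffOn.sum fun i _ => (sol_B hT hsol i).pow 2
  exact ((smT_const hψ).pow 4).mul h

lemma energy_ineq (hT : 0 < T) (hsol : IsHallMHDSolution 1 1 1 (Icc 0 T) u b π) {ψ : R2 → ℝ}
    {M : ℝ} {K : Set R2} (hψ : Sm ψ) (h0 : ∀ x, 0 ≤ ψ x) (h1 : ∀ x, ψ x ≤ 1)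
    (hM : ∀ k x, |pd k ψ x| ≤ M) (hK : IsCompact K) (hs : tsupport ψ ⊆ K)
    {t : ℝ} (ht : t ∈ Ioo 0 T) :
    ∃ y', HasDerivAt (fun t => ∫ x in K, ψ x ^ 4 * ∑ i, (b t x i + curl (u t) x i) ^ 2) y' t ∧
      y' ≤ -(∫ x in K, ψ x ^ 4 * ∑ i, ∑ k, (pd k (fun y => b t y i + curl (u t) y i) x) ^ 2)
      + 24*(48*((∫ x in K, ∑ i, u t x i ^ 2)*(2*(∫ x in K, ∑ i, ∑ k, (pd k (fun y => u t y i) x) ^ 2)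
          +4*M^2*∫ x in K, ∑ i, u t x i ^ 2))
        + 48*∫ x in K, ∑ i, ∑ k, (pd k (fun y => u t y i) x) ^ 2)
        *(∫ x in K, ψ x ^ 4 * ∑ i, (b t x i + curl (u t) x i) ^ 2)
      + 76*M^2*∫ x in K, ∑ i, (b t x i + curl (u t) x i) ^ 2 := by
  have htc := Ioo_subset_Icc_self ht
  refine ⟨_, deriv_int hT (smT_y hT hsol hψ) hK ht, ?_⟩
  refine le_trans (le_of_eq ?_) (static_estimate (B := fun i y => b t y i + curl (u t) y i)
    (u := fun i y => u t y i) hψ (fun i => (sol_B hT hsol i).slice htc)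
    (fun i => (sol_u hsol i).slice htc) h0 h1 hM hK hs (hsol.div_u t htc))
  congr 1
  ext x
  refine ((smT_y hT hsol hψ).hasDerivAt ht x).unique ?_
  refine HasDerivAt.const_mul _ ?_
  have h3 := HasDerivAt.fun_sum (u := (Finset.univ : Finset (Fin 3)))
    (fun i _ => (B_eq hT hsol ht x i).pow 2)
  refine HasDerivAt.congr_deriv h3 ?_
  refine Finset.sum_congr rfl fun i _ => ?_
  push_cast; ring
end
end

section
open MeasureTheory Set

/-- A scalar function is given by a Schwartz map. -/
def IsS (f : R2 → ℝ) : Prop := ∃ g : SchwartzMap R2 ℝ, ∀ x, g x = f x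

lemma IsS.sq {f : R2 → ℝ} (h : IsS f) : Integrable (fun x => f x ^ 2) := by
  obtain ⟨g, hg⟩ := h
  have := (g.memLp 2 volume).integrable_sq
  simpa only [hg] using this

lemma IsS.pd {f : R2 → ℝ} (h : IsS f) (k : Fin 2) : IsS (pd k f) := by
  obtain ⟨g, hg⟩ := h
  obtain rfl : ⇑g = f := funext hg
  exact ⟨SchwartzMap.evalCLM ℝ R2 ℝ (Pi.single k 1) (SchwartzMap.fderivCLM ℝ R2 ℝ g), fun x => rfl⟩

lemma IsS.add {f g : R2 → ℝ} (hf : IsS f) (hg : IsS g) : IsS (fun x => f x + g x) := by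
  obtain ⟨p, hp⟩ := hf
  obtain ⟨q, hq⟩ := hg
  exact ⟨p + q, fun x => by simp [hp, hq]⟩

lemma IsS.neg {f : R2 → ℝ} (hf : IsS f) : IsS (fun x => - f x) := by
  obtain ⟨p, hp⟩ := hf
  exact ⟨- p, fun x => by simp [hp]⟩

lemma IsS.sub {f g : R2 → ℝ} (hf : IsS f) (hg : IsS g) : IsS (fun x => f x - g x) := by
  obtain ⟨p, hp⟩ := hf
  obtain ⟨q, hq⟩ := hg
  exact ⟨p - q, fun x => by simp [hp, hq]⟩

lemma IsSchwartz.isS {f : R2 → Fin 3 → ℝ} (h : IsSchwartz f) (i : Fin 3) :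
    IsS (fun x => f x i) :=
  ⟨(SchwartzMap.postcompCLM (ContinuousLinearMap.proj (R := ℝ) (φ := fun _ : Fin 3 => ℝ) i)
    (⟨f, h.1, h.2⟩ : SchwartzMap R2 (Fin 3 → ℝ))), fun x => rfl⟩

lemma IsSchwartz.curl_isS {f : R2 → Fin 3 → ℝ} (h : IsSchwartz f) (i : Fin 3) :
    IsS (fun x => curl f x i) := by
  fin_cases i
  · exact (h.isS 2).pd 1
  · exact ((h.isS 2).pd 0).neg
  · exact ((h.isS 1).pd 0).sub ((h.isS 0).pd 1)

lemma sum_sq_int {f : Fin 3 → R2 → ℝ} (h : ∀ i, IsS (f i)) :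
    Integrable (fun x => ∑ i, f i x ^ 2) := integrable_finsetSum _ fun i _ => (h i).sq

lemma sum_pd_int {f : Fin 3 → R2 → ℝ} (h : ∀ i, IsS (f i)) :
    Integrable (fun x => ∑ i, ∑ k, pd k (f i) x ^ 2) :=
  integrable_finsetSum _ fun i _ => integrable_finsetSum _ fun k _ => ((h i).pd k).sq

lemma cutoff : ∃ (M : ℝ) (ψ : ℕ → R2 → ℝ) (K : ℕ → Set R2), ∀ n, Sm (ψ n) ∧ (∀ x, 0 ≤ ψ n x) ∧
    (∀ x, ψ n x ≤ 1) ∧ (∀ k x, |pd k (ψ n) x| ≤ M) ∧ IsCompact (K n) ∧ tsupport (ψ n) ⊆ K n ∧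
    ∀ x, Filter.Tendsto (fun n => ψ n x) Filter.atTop (nhds 1) := by
  let φ : ContDiffBump (0 : R2) := ⟨1, 2, one_pos, one_lt_two⟩
  have hφ : Sm (φ : R2 → ℝ) := φ.contDiff
  have hb : ∀ k, ∃ C, ∀ x, |pd k φ x| ≤ C := fun k =>
    (pd_hasCompactSupport φ.hasCompactSupport k).exists_bound_of_continuous (hφ.pd k).continuous
  choose C hC using hb
  have hC0 : ∀ k, 0 ≤ C k := fun k => (abs_nonneg _).trans (hC k 0)
  have hr : ∀ n : ℕ, (0:ℝ) < ((n:ℝ) + 1)⁻¹ := fun n => by positivity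
  refine ⟨C 0 + C 1, fun n x => φ (((n:ℝ) + 1)⁻¹ • x),
    fun n => Metric.closedBall 0 (2 * ((n:ℝ)+1)), fun n => ⟨?_, fun x => φ.nonneg,
      fun x => φ.le_one, ?_, isCompact_closedBall _ _, ?_, ?_⟩⟩
  · exact hφ.comp (contDiff_const_smul _)
  · intro k x
    have h1 : HasFDerivAt (fun x : R2 => φ (((n:ℝ) + 1)⁻¹ • x))
        ((fderiv ℝ φ (((n:ℝ) + 1)⁻¹ • x)).comp
          (((n:ℝ) + 1)⁻¹ • ContinuousLinearMap.id ℝ R2)) x :=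
      HasFDerivAt.comp (g := φ) (f := fun x : R2 => ((n:ℝ) + 1)⁻¹ • x) x
        (hφ.diff _).hasFDerivAt ((hasFDerivAt_id x).fun_const_smul (((n:ℝ) + 1)⁻¹))
    have h2 : pd k (fun x : R2 => φ (((n:ℝ) + 1)⁻¹ • x)) x
        = ((n:ℝ) + 1)⁻¹ * pd k φ (((n:ℝ) + 1)⁻¹ • x) := by
      unfold pd; rw [h1.fderiv]; simp
    rw [h2, abs_mul, abs_of_pos (hr n)]
    have h3 : ((n:ℝ) + 1)⁻¹ ≤ 1 := inv_le_one_of_one_le₀ (by linarith [n.cast_nonneg (α := ℝ)])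
    have h4 := hC k (((n:ℝ) + 1)⁻¹ • x)
    have h5 : C k ≤ C 0 + C 1 := by
      fin_cases k
      · simpa using hC0 1
      · simpa using hC0 0
    calc _ ≤ 1 * C k := mul_le_mul h3 h4 (abs_nonneg _) zero_le_one
      _ ≤ _ := by linarith
  · refine closure_minimal (fun x hx => ?_) Metric.isClosed_closedBall
    have h1 : ((n:ℝ) + 1)⁻¹ • x ∈ Function.support φ := hx
    rw [φ.support_eq, mem_ball_zero_iff, norm_smul, Real.norm_of_nonneg (hr n).le] at h1
    rw [mem_closedBall_zero_iff]
    have hn : (0:ℝ) < (n:ℝ) + 1 := by positivity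
    have h2 : ((n:ℝ) + 1)⁻¹ * ‖x‖ < 2 := h1
    rw [inv_mul_lt_iff₀ hn] at h2
    linarith
  · intro x
    refine tendsto_const_nhds.congr' ?_
    filter_upwards [Filter.eventually_ge_atTop ⌈‖x‖⌉₊] with n hn
    refine (φ.one_of_mem_closedBall ?_).symm
    rw [mem_closedBall_zero_iff, norm_smul, Real.norm_of_nonneg (hr n).le]
    change _ ≤ (1:ℝ)
    have hn' : (0:ℝ) < (n:ℝ) + 1 := by positivity
    rw [inv_mul_le_iff₀ hn']
    have := (Nat.le_ceil ‖x‖).trans (Nat.cast_le.2 hn)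
    linarith

lemma fatou_int {α : Type*} [MeasurableSpace α] {μ : Measure α} {f : ℕ → α → ℝ} {F : α → ℝ}
    {R : ℝ} (hf : ∀ n, Integrable (f n) μ) (h0 : ∀ n, ∀ᵐ x ∂μ, 0 ≤ f n x)
    (hR : ∀ n, ∫ x, f n x ∂μ ≤ R)
    (hlim : ∀ᵐ x ∂μ, Filter.Tendsto (fun n => f n x) Filter.atTop (nhds (F x))) :
    Integrable F μ := by
  refine ⟨aestronglyMeasurable_of_tendsto_ae _ (fun n => (hf n).1) hlim, ?_⟩
  have h1 : ∫⁻ x, ‖F x‖ₑ ∂μ ≤ Filter.liminf (fun n => ∫⁻ x, ‖f n x‖ₑ ∂μ) Filter.atTop := by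
    refine le_trans (le_of_eq ?_) (lintegral_liminf_le' (fun n => (hf n).1.enorm))
    refine lintegral_congr_ae ?_
    filter_upwards [hlim] with x hx
    exact hx.enorm.liminf_eq.symm
  refine lt_of_le_of_lt (h1.trans ?_) (ENNReal.ofReal_lt_top (r := R))
  refine Filter.liminf_le_of_frequently_le' (Filter.Frequently.of_forall fun n => ?_)
  rw [← ofReal_integral_norm_eq_lintegral_enorm (hf n)]
  refine ENNReal.ofReal_le_ofReal (le_trans (le_of_eq ?_) (hR n))
  refine integral_congr_ae ?_
  filter_upwards [h0 n] with x hx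
  exact Real.norm_of_nonneg hx

lemma cut_tendsto {ψ : ℕ → R2 → ℝ} {K : ℕ → Set R2} {f : R2 → ℝ} (hf : Integrable f)
    (hψ : ∀ n, Continuous (ψ n)) (h0 : ∀ n x, 0 ≤ ψ n x) (h1 : ∀ n x, ψ n x ≤ 1)
    (hs : ∀ n, tsupport (ψ n) ⊆ K n)
    (hl : ∀ x, Filter.Tendsto (fun n => ψ n x) Filter.atTop (nhds 1)) :
    Filter.Tendsto (fun n => ∫ x in K n, ψ n x ^ 4 * f x) Filter.atTop (nhds (∫ x, f x)) := by
  have e : ∀ n, ∫ x in K n, ψ n x ^ 4 * f x = ∫ x, ψ n x ^ 4 * f x := by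
    intro n
    refine setIntegral_eq_integral_of_forall_compl_eq_zero fun x hx => ?_
    rw [image_eq_zero_of_notMem_tsupport (fun h => hx (hs n h))]; simp
  simp only [e]
  refine tendsto_integral_of_dominated_convergence (fun x => ‖f x‖)
    (fun n => ((hψ n).pow 4).aestronglyMeasurable.mul hf.1) hf.norm (fun n => ?_) ?_
  · filter_upwards with x
    rw [norm_mul, Real.norm_of_nonneg (pow_nonneg (h0 n x) 4)]
    exact mul_le_of_le_one_left (norm_nonneg _) (pow_le_one₀ (h0 n x) (h1 n x))
  · filter_upwards with x
    simpa using ((hl x).pow 4).mul_const (f x)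
end

/-- Proposition 3.1: for a smooth solution of the 2½-dimensional Hall-MHD system with
`ν = η = ε = 1` satisfying the energy-class bounds, the vorticity `ω = ∇×u` lies in
`L^∞_T L²_x ∩ L²_T Ḣ¹_x`. -/
theorem vorticity_energy_class (T : ℝ) (hT : 0 < T)
    (u b : ℝ → (Fin 2 → ℝ) → (Fin 3 → ℝ)) (π : ℝ → (Fin 2 → ℝ) → ℝ)
    (hsol : IsHallMHDSolution 1 1 1 (Set.Icc 0 T) u b π)
    (henergy : ∃ C : ℝ, ∀ t ∈ Set.Icc (0 : ℝ) T,
      (∫ x, ((∑ i, (u t x i) ^ 2) + ∑ i, (b t x i) ^ 2)) ≤ C)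
    (hdiss : IntegrableOn
      (fun t => ∫ x, ((∑ i, ∑ k, (pd k (fun y => u t y i) x) ^ 2)
        + ∑ i, ∑ k, (pd k (fun y => b t y i) x) ^ 2))
      (Set.Icc (0 : ℝ) T))
    (homega0 : Integrable (fun x => ∑ i, (curl (u 0) x i) ^ 2)) :
    (∃ C : ℝ, ∀ t ∈ Set.Icc (0 : ℝ) T,
        (∫ x, ∑ i, (curl (u t) x i) ^ 2) ≤ C) ∧
      IntegrableOn
        (fun t => ∫ x, ∑ i, ∑ k, (pd k (fun y => curl (u t) y i) x) ^ 2)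
        (Set.Icc (0 : ℝ) T) := by
  classical
  obtain ⟨C0, hC0⟩ := henergy
  obtain ⟨M, ψ, K, hcut⟩ := cutoff
  set D : ℝ → ℝ := fun t => ∫ x, ((∑ i, ∑ k, (pd k (fun y => u t y i) x) ^ 2)
        + ∑ i, ∑ k, (pd k (fun y => b t y i) x) ^ 2) with hD
  have hψ := fun n => (hcut n).1
  have h0 := fun n => (hcut n).2.1
  have h1 := fun n => (hcut n).2.2.1
  have hM := fun n => (hcut n).2.2.2.1
  have hK := fun n => (hcut n).2.2.2.2.1
  have hs := fun n => (hcut n).2.2.2.2.2.1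
  have hl := (hcut 0).2.2.2.2.2.2
  have su := fun t (ht : t ∈ Set.Icc 0 T) => (hsol.schwartz_u t ht).isS
  have sb := fun t (ht : t ∈ Set.Icc 0 T) => (hsol.schwartz_b t ht).isS
  have sw := fun t (ht : t ∈ Set.Icc 0 T) => (hsol.schwartz_u t ht).curl_isS
  have sB := fun t (ht : t ∈ Set.Icc 0 T) i => (sb t ht i).add (sw t ht i)
  have Tu := sol_u hsol
  have Tb := sol_b hsol
  have Tw := smT_curl hT Tu
  have TB := sol_B hT hsol
  -- elementary bounds
  have D0 : ∀ t, 0 ≤ D t := fun t => integral_nonneg fun x => by positivity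
  have hu_le : ∀ t ∈ Set.Icc 0 T, ∫ x, ∑ i, u t x i ^ 2 ≤ C0 := by
    intro t ht
    refine le_trans (integral_mono (sum_sq_int (su t ht))
      ((sum_sq_int (su t ht)).add (sum_sq_int (sb t ht))) fun x => ?_) (hC0 t ht)
    exact le_add_of_nonneg_right (by positivity)
  have hb_le : ∀ t ∈ Set.Icc 0 T, ∫ x, ∑ i, b t x i ^ 2 ≤ C0 := by
    intro t ht
    refine le_trans (integral_mono (sum_sq_int (sb t ht))
      ((sum_sq_int (su t ht)).add (sum_sq_int (sb t ht))) fun x => ?_) (hC0 t ht)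
    exact le_add_of_nonneg_left (by positivity)
  have hdu_le : ∀ t ∈ Set.Icc 0 T, ∫ x, ∑ i, ∑ k, pd k (fun y => u t y i) x ^ 2 ≤ D t := by
    intro t ht
    refine integral_mono (sum_pd_int (su t ht))
      ((sum_pd_int (su t ht)).add (sum_pd_int (sb t ht))) fun x => ?_
    exact le_add_of_nonneg_right (by positivity)
  have hdb_le : ∀ t ∈ Set.Icc 0 T, ∫ x, ∑ i, ∑ k, pd k (fun y => b t y i) x ^ 2 ≤ D t := by
    intro t ht
    refine integral_mono (sum_pd_int (sb t ht))
      ((sum_pd_int (su t ht)).add (sum_pd_int (sb t ht))) fun x => ?_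
    exact le_add_of_nonneg_left (by positivity)
  have hC0n : 0 ≤ C0 := le_trans (integral_nonneg fun x => by positivity)
    (hu_le 0 (Set.left_mem_Icc.2 hT.le))
  have hB_le : ∀ t ∈ Set.Icc 0 T, ∫ x, ∑ i, (b t x i + curl (u t) x i) ^ 2
      ≤ 2 * C0 + 4 * D t := by
    intro t ht
    have h3 : ∫ x, ∑ i, (b t x i + curl (u t) x i) ^ 2
        ≤ ∫ x, (2 * (∑ i, b t x i ^ 2) + 4 * ∑ i, ∑ k, pd k (fun y => u t y i) x ^ 2) := by
      refine integral_mono (sum_sq_int (sB t ht)) (((sum_sq_int (sb t ht)).const_mul 2).add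
        ((sum_pd_int (su t ht)).const_mul 4)) fun x => ?_
      have c0 : curl (u t) x 0 = pd 1 (fun y => u t y 2) x := rfl
      have c1 : curl (u t) x 1 = - pd 0 (fun y => u t y 2) x := rfl
      have c2 : curl (u t) x 2 = pd 0 (fun y => u t y 1) x - pd 1 (fun y => u t y 0) x := rfl
      simp only [Fin.sum_univ_three, Fin.sum_univ_two, c0, c1, c2]
      generalize pd 1 (fun y => u t y 2) x = p12
      generalize pd 0 (fun y => u t y 2) x = p02
      generalize pd 1 (fun y => u t y 1) x = p11
      generalize pd 0 (fun y => u t y 1) x = p01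
      generalize pd 1 (fun y => u t y 0) x = p10
      generalize pd 0 (fun y => u t y 0) x = p00
      linarith [sq_nonneg (b t x 0 - p12), sq_nonneg (b t x 1 + p02),
        sq_nonneg (b t x 2 - (p01 - p10)), sq_nonneg (p01 + p10), sq_nonneg p11, sq_nonneg p00,
        sq_nonneg p12, sq_nonneg p02]
    rw [integral_add ((sum_sq_int (sb t ht)).const_mul 2)
        ((sum_pd_int (su t ht)).const_mul 4), integral_const_mul, integral_const_mul] at h3
    linarith [hb_le t ht, hdu_le t ht]
  have loc : ∀ (n : ℕ) {f : R2 → ℝ}, Integrable f → (∀ x, 0 ≤ f x) →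
      ∫ x in K n, f x ≤ ∫ x, f x := fun n f hf hf0 =>
    setIntegral_le_integral hf (Filter.Eventually.of_forall hf0)
  have locψ : ∀ (n : ℕ) {f : R2 → ℝ}, Integrable f → (∀ x, 0 ≤ f x) →
      ∫ x in K n, ψ n x ^ 4 * f x ≤ ∫ x, f x := by
    intro n f hf hf0
    refine le_trans ?_ (loc n hf hf0)
    refine integral_mono_of_nonneg (Filter.Eventually.of_forall fun x => ?_) hf.integrableOn
      (Filter.Eventually.of_forall fun x => ?_)
    · exact mul_nonneg (pow_nonneg (h0 n x) 4) (hf0 x)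
    · exact mul_le_of_le_one_left (hf0 x) (pow_le_one₀ (h0 n x) (h1 n x))
  -- continuity in time
  have cu : ∀ n, ContinuousOn (fun t => ∫ x in K n, ∑ i, u t x i ^ 2) (Set.Icc 0 T) := fun n =>
    cont_int hT (continuousOn_finsetSum _ fun i _ => (Tu i).continuousOn.pow 2) (hK n)
  have cdu : ∀ n, ContinuousOn (fun t => ∫ x in K n, ∑ i, ∑ k, pd k (fun y => u t y i) x ^ 2)
      (Set.Icc 0 T) := fun n =>
    cont_int hT (continuousOn_finsetSum _ fun i _ => continuousOn_finsetSum _ fun k _ =>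
      ((Tu i).pd hT k).continuousOn.pow 2) (hK n)
  have cB : ∀ n, ContinuousOn (fun t => ∫ x in K n, ∑ i, (b t x i + curl (u t) x i) ^ 2)
      (Set.Icc 0 T) := fun n =>
    cont_int hT (continuousOn_finsetSum _ fun i _ => (TB i).continuousOn.pow 2) (hK n)
  have cψ : ∀ n, ContinuousOn (fun p : ℝ × R2 => ψ n p.2 ^ 4) (Slab T) := fun n =>
    (((hψ n).continuous.comp continuous_snd).pow 4).continuousOn
  have cy : ∀ n, ContinuousOn (fun t => ∫ x in K n, ψ n x ^ 4 *
      ∑ i, (b t x i + curl (u t) x i) ^ 2) (Set.Icc 0 T) := fun n =>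
    cont_int hT (smT_y hT hsol (hψ n)).continuousOn (hK n)
  have cg : ∀ n, ContinuousOn (fun t => ∫ x in K n, ψ n x ^ 4 *
      ∑ i, ∑ k, (pd k (fun y => b t y i + curl (u t) y i) x) ^ 2) (Set.Icc 0 T) := fun n =>
    cont_int hT ((cψ n).mul (continuousOn_finsetSum _ fun i _ => continuousOn_finsetSum _
      fun k _ => ((TB i).pd hT k).continuousOn.pow 2)) (hK n)
  have cH : ∀ n, ContinuousOn (fun t => ∫ x in K n, ψ n x ^ 4 *
      ∑ i, ∑ k, (pd k (fun y => curl (u t) y i) x) ^ 2) (Set.Icc 0 T) := fun n =>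
    cont_int hT ((cψ n).mul (continuousOn_finsetSum _ fun i _ => continuousOn_finsetSum _
      fun k _ => ((Tw i).pd hT k).continuousOn.pow 2)) (hK n)
  -- Gronwall
  have hDi : IntegrableOn D (Set.Icc 0 T) := hdiss
  have hci : ∀ c : ℝ, IntegrableOn (fun _ : ℝ => c) (Set.Icc 0 T) := fun c =>
    continuousOn_const.integrableOn_Icc
  set α : ℝ → ℝ := fun t => 24*(48*(C0*(2*D t+4*M^2*C0)) + 48*D t) with hα
  set γ : ℝ → ℝ := fun t => 76*M^2*(2 * C0 + 4 * D t) with hγ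
  have hαi : IntegrableOn α (Set.Icc 0 T) :=
    (((((hDi.const_mul 2).add (hci (4*M^2*C0))).const_mul C0).const_mul 48).add
      (hDi.const_mul 48)).const_mul 24
  have hγi : IntegrableOn γ (Set.Icc 0 T) :=
    ((hci (2*C0)).add (hDi.const_mul 4)).const_mul (76*M^2)
  set R : ℝ := Real.exp (∫ t in Set.Icc 0 T, α t) *
    ((∫ x, ∑ i, (b 0 x i + curl (u 0) x i) ^ 2) + ∫ t in Set.Icc 0 T, γ t) with hR
  have main : ∀ n, (∀ t ∈ Set.Icc 0 T,
      ∫ x in K n, ψ n x ^ 4 * ∑ i, (b t x i + curl (u t) x i) ^ 2 ≤ R) ∧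
      ∫ t in Set.Icc 0 T, ∫ x in K n, ψ n x ^ 4 *
        ∑ i, ∑ k, (pd k (fun y => b t y i + curl (u t) y i) x) ^ 2 ≤ R := by
    intro n
    have hin := Set.left_mem_Icc.2 hT.le
    have hstart : ∫ x in K n, ψ n x ^ 4 * ∑ i, (b 0 x i + curl (u 0) x i) ^ 2
        ≤ ∫ x, ∑ i, (b 0 x i + curl (u 0) x i) ^ 2 :=
      locψ n (sum_sq_int (sB 0 hin)) (fun x => by positivity)
    have ψ4 : ∀ x, 0 ≤ ψ n x ^ 4 := fun x => pow_nonneg (h0 n x) 4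
    have ca : ContinuousOn (fun t => 24*(48*((∫ x in K n, ∑ i, u t x i ^ 2)*
          (2*(∫ x in K n, ∑ i, ∑ k, (pd k (fun y => u t y i) x) ^ 2)
          +4*M^2*∫ x in K n, ∑ i, u t x i ^ 2))
        + 48*∫ x in K n, ∑ i, ∑ k, (pd k (fun y => u t y i) x) ^ 2)) (Set.Icc 0 T) := by
      have e1 := cu n
      have e2 := cdu n
      fun_prop
    have cc : ContinuousOn (fun t => 76*M^2*∫ x in K n, ∑ i, (b t x i + curl (u t) x i) ^ 2)
        (Set.Icc 0 T) := continuousOn_const.mul (cB n)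
    have e0 : ∀ t, 0 ≤ ∫ x in K n, ∑ i, u t x i ^ 2 := fun t =>
      integral_nonneg fun x => by positivity
    have d0 : ∀ t, 0 ≤ ∫ x in K n, ∑ i, ∑ k, (pd k (fun y => u t y i) x) ^ 2 := fun t =>
      integral_nonneg fun x => by positivity
    have m0 : ∀ t, 0 ≤ ∫ x in K n, ∑ i, (b t x i + curl (u t) x i) ^ 2 := fun t =>
      integral_nonneg fun x => by positivity
    have key := gronwall hT (cy n) (cg n) ca cc
      (fun t _ => integral_nonneg fun x => mul_nonneg (ψ4 x) (by positivity))
      (fun t _ => integral_nonneg fun x => mul_nonneg (ψ4 x) (by positivity))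
      (fun t _ => by have := e0 t; have := d0 t; positivity)
      (fun t _ => by have := m0 t; positivity)
      (fun t ht => energy_ineq hT hsol (hψ n) (h0 n) (h1 n) (hM n) (hK n) (hs n) ht)
      (A := ∫ t in Set.Icc 0 T, α t) (C := ∫ t in Set.Icc 0 T, γ t)
      (setIntegral_mono_on ca.integrableOn_Icc hαi measurableSet_Icc fun t ht => by
        have h3 := (loc n (sum_sq_int (su t ht)) (fun x => by positivity)).trans (hu_le t ht)
        have h4 := (loc n (sum_pd_int (su t ht)) (fun x => by positivity)).trans (hdu_le t ht)
        have := e0 t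
        have := d0 t
        have := D0 t
        simp only [hα]
        gcongr)
      (setIntegral_mono_on cc.integrableOn_Icc hγi measurableSet_Icc fun t ht => by
        have h3 := (loc n (sum_sq_int (sB t ht)) (fun x => by positivity)).trans (hB_le t ht)
        simp only [hγ]
        gcongr)
    have hle : Real.exp (∫ t in Set.Icc 0 T, α t) *
        ((∫ x in K n, ψ n x ^ 4 * ∑ i, (b 0 x i + curl (u 0) x i) ^ 2)
          + ∫ t in Set.Icc 0 T, γ t) ≤ R := by
      simp only [hR]
      gcongr
    exact ⟨fun t ht => (key.1 t ht).trans hle, key.2.trans hle⟩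
  refine ⟨⟨2 * R + 2 * C0, fun t ht => ?_⟩, ?_⟩
  · have h3 : ∫ x, ∑ i, (b t x i + curl (u t) x i) ^ 2 ≤ R :=
      le_of_tendsto' (cut_tendsto (sum_sq_int (sB t ht)) (fun n => (hψ n).continuous) h0 h1 hs hl)
        (fun n => (main n).1 t ht)
    have h4 : ∫ x, ∑ i, curl (u t) x i ^ 2
        ≤ ∫ x, (2 * (∑ i, (b t x i + curl (u t) x i) ^ 2) + 2 * ∑ i, b t x i ^ 2) := by
      refine integral_mono (sum_sq_int (sw t ht)) (((sum_sq_int (sB t ht)).const_mul 2).add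
        ((sum_sq_int (sb t ht)).const_mul 2)) fun x => ?_
      simp only [Finset.mul_sum, ← Finset.sum_add_distrib]
      refine Finset.sum_le_sum fun i _ => ?_
      nlinarith [sq_nonneg (2 * b t x i + curl (u t) x i)]
    rw [integral_add ((sum_sq_int (sB t ht)).const_mul 2)
        ((sum_sq_int (sb t ht)).const_mul 2), integral_const_mul, integral_const_mul] at h4
    linarith [hb_le t ht]
  · refine fatou_int (R := 2 * R + 2 * ∫ t in Set.Icc 0 T, D t)
      (f := fun n t => ∫ x in K n, ψ n x ^ 4 *
        ∑ i, ∑ k, (pd k (fun y => curl (u t) y i) x) ^ 2) (fun n => (cH n).integrableOn_Icc)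
      (fun n => Filter.Eventually.of_forall fun t => integral_nonneg fun x =>
        mul_nonneg (pow_nonneg (h0 n x) 4) (by positivity)) (fun n => ?_) ?_
    · have gi := (cg n).integrableOn_Icc (μ := volume)
      have h3 : ∫ t in Set.Icc 0 T, ∫ x in K n, ψ n x ^ 4 *
          ∑ i, ∑ k, (pd k (fun y => curl (u t) y i) x) ^ 2 ≤
          ∫ t in Set.Icc 0 T, (2 * (∫ x in K n, ψ n x ^ 4 *
            ∑ i, ∑ k, (pd k (fun y => b t y i + curl (u t) y i) x) ^ 2) + 2 * D t) := by
        refine setIntegral_mono_on (cH n).integrableOn_Icc ((gi.const_mul 2).add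
          (hDi.const_mul 2)) measurableSet_Icc fun t ht => ?_
        have q1 : Continuous (fun x => ψ n x ^ 4 *
            ∑ i, ∑ k, (pd k (fun y => curl (u t) y i) x) ^ 2) :=
          ((hψ n).continuous.pow 4).mul (continuous_finsetSum _ fun i _ =>
            continuous_finsetSum _ fun k _ => (((Tw i).slice ht).pd k).continuous.pow 2)
        have q2 : Continuous (fun x => ψ n x ^ 4 *
            ∑ i, ∑ k, (pd k (fun y => b t y i + curl (u t) y i) x) ^ 2) :=
          ((hψ n).continuous.pow 4).mul (continuous_finsetSum _ fun i _ =>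
            continuous_finsetSum _ fun k _ => (((TB i).slice ht).pd k).continuous.pow 2)
        have q3 : Continuous (fun x => ψ n x ^ 4 *
            ∑ i, ∑ k, (pd k (fun y => b t y i) x) ^ 2) :=
          ((hψ n).continuous.pow 4).mul (continuous_finsetSum _ fun i _ =>
            continuous_finsetSum _ fun k _ => (((Tb i).slice ht).pd k).continuous.pow 2)
        have h4 : ∫ x in K n, ψ n x ^ 4 * ∑ i, ∑ k, (pd k (fun y => curl (u t) y i) x) ^ 2 ≤
            ∫ x in K n, (2 * (ψ n x ^ 4 *
              ∑ i, ∑ k, (pd k (fun y => b t y i + curl (u t) y i) x) ^ 2)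
              + 2 * (ψ n x ^ 4 * ∑ i, ∑ k, (pd k (fun y => b t y i) x) ^ 2)) := by
          refine int_on_mono q1 ((continuous_const.mul q2).add (continuous_const.mul q3)) (hK n)
            fun x => ?_
          have h5 : ∑ i, ∑ k, (pd k (fun y => curl (u t) y i) x) ^ 2 ≤
              2 * (∑ i, ∑ k, (pd k (fun y => b t y i + curl (u t) y i) x) ^ 2)
              + 2 * ∑ i, ∑ k, (pd k (fun y => b t y i) x) ^ 2 := by
            simp only [Finset.mul_sum, ← Finset.sum_add_distrib]
            refine Finset.sum_le_sum fun i _ => Finset.sum_le_sum fun k _ => ?_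
            rw [pd_add ((Tb i).slice ht) ((Tw i).slice ht)]
            nlinarith [sq_nonneg (2 * pd k (fun y => b t y i) x
              + pd k (fun y => curl (u t) y i) x)]
          have := mul_le_mul_of_nonneg_left h5 (pow_nonneg (h0 n x) 4)
          simp only [Pi.add_apply, Pi.mul_apply]
          linarith
        rw [integral_add ((int_on q2 (hK n)).const_mul 2) ((int_on q3 (hK n)).const_mul 2),
          integral_const_mul, integral_const_mul] at h4
        linarith [locψ n (sum_pd_int (sb t ht)) (fun x => by positivity), hdb_le t ht]
      rw [integral_add (gi.const_mul 2) (hDi.const_mul 2), integral_const_mul,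
        integral_const_mul] at h3
      linarith [(main n).2]
    · filter_upwards [ae_restrict_mem measurableSet_Icc] with t ht
      exact cut_tendsto (sum_pd_int (sw t ht)) (fun n => (hψ n).continuous) h0 h1 hs hl
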